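/- arXiv:2107.00446 — 4 statements merged into one kernel-verified Lean document; each statement's English description precedes it below -/
import Mathlib

section
/- There exists a constant c such that the following holds: for every labeled tree T with n ≥ 1 edges, whose edges are labeled by strings of length at most ℓ over a weighted alphabet Γ, there is a contracting SLP over Γ with at most c·n variables, in which every right-hand side has length at most c·ℓ, that defines all nonempty prefixes in T. -/
/-- A straight-line program: every variable has exactly one rule `rhs A`,
and a ranking witnesses acyclicity (variables on right-hand sides have
smaller rank), so every variable derives a unique string `val A`. -/
structure SLP (V : Type) (Γ : Type) where
  rhs : V → List (V ⊕ Γ)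
  rank : V → ℕ
  rank_lt : ∀ A B, Sum.inl B ∈ rhs A → rank B < rank A
  start : V

namespace SLP

variable {V Γ : Type}

/-- The string derived by a variable. -/
def val (G : SLP V Γ) (A : V) : List Γ :=
  ((G.rhs A).attach.map (fun β =>
    match β with
    | ⟨Sum.inl B, _⟩ => G.val B
    | ⟨Sum.inr a, _⟩ => [a])).flatten
termination_by G.rank A
decreasing_by exact G.rank_lt _ _ (by assumption)

/-- A string is defined by the SLP if some variable derives it. -/
def defines (G : SLP V Γ) (s : List Γ) : Prop := ∃ A, G.val A = s

/-- The size of an SLP: total length of all right-hand sides. -/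
def size [Fintype V] (G : SLP V Γ) : ℕ := ∑ A : V, (G.rhs A).length

end SLP

/-- Weight of a string over a weighted alphabet. -/
def wstr {Γ : Type} (w : Γ → ℕ) (s : List Γ) : ℕ := (s.map w).sum

namespace SLP

variable {V Γ : Type}

/-- Weight of the string derived by a variable. -/
def wval (G : SLP V Γ) (w : Γ → ℕ) (A : V) : ℕ := wstr w (G.val A)

/-- Weight of a symbol (variable or terminal). -/
def symWeight (G : SLP V Γ) (w : Γ → ℕ) : V ⊕ Γ → ℕ
  | Sum.inl B => G.wval w B
  | Sum.inr a => w a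

/-- An SLP is contracting (w.r.t. the weight `w`) if every variable `B` on the
right-hand side of a rule of `A` satisfies `‖B‖ ≤ ‖A‖/2`. -/
def Contracting (G : SLP V Γ) (w : Γ → ℕ) : Prop :=
  ∀ A B, Sum.inl B ∈ G.rhs A → 2 * G.wval w B ≤ G.wval w A

end SLP


/-- A labeled rooted tree: each non-root node `v` has a parent, and the edge from
the parent to `v` is labeled by the string `label v`; a depth function witnesses
well-foundedness of the parent relation. -/
structure LTree (ν Γ : Type) where
  root : ν
  parent : ν → Option ν
  label : ν → List Γ
  depth : ν → ℕ
  parent_eq_none : ∀ v, parent v = none ↔ v = root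
  depth_lt : ∀ v u, parent v = some u → depth u < depth v

namespace LTree

variable {ν Γ : Type}

/-- The prefix in `T` at node `v`: the concatenation of the edge labels along the
path from the root to `v`. -/
def prefixAt (T : LTree ν Γ) (v : ν) : List Γ :=
  match h : T.parent v with
  | none => []
  | some u => T.prefixAt u ++ T.label v
termination_by T.depth v
decreasing_by exact T.depth_lt v u h

/-- A node is a leaf if it has no children. -/
def IsLeaf (T : LTree ν Γ) (v : ν) : Prop := ∀ u, T.parent u ≠ some v

/-- A caterpillar tree: every node has at most one child that is not a leaf. -/
def Caterpillar (T : LTree ν Γ) : Prop :=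
  ∀ u v₁ v₂, T.parent v₁ = some u → T.parent v₂ = some u →
    ¬T.IsLeaf v₁ → ¬T.IsLeaf v₂ → v₁ = v₂

end LTree

/-- `Pieces P k a c` says that `c` is reached from `a` by at most `k` steps of `P`. -/
inductive Pieces {ν : Type} (P : ν → ν → Prop) : ℕ → ν → ν → Prop
  | nil (k : ℕ) (a : ν) : Pieces P k a a
  | cons {k : ℕ} {a b c : ν} : P a b → Pieces P k b c → Pieces P (k + 1) a c

namespace Pieces

variable {ν : Type} {P Q : ν → ν → Prop}

theorem mono_count {k : ℕ} {a c : ν} (h : Pieces P k a c) :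
    ∀ {k' : ℕ}, k ≤ k' → Pieces P k' a c := by
  induction h with
  | nil k a => intro k' _; exact .nil _ _
  | cons hp _ ih =>
    intro k' hk
    obtain ⟨m, rfl⟩ : ∃ m, k' = m + 1 := ⟨k' - 1, by omega⟩
    exact .cons hp (ih (by omega))

theorem imp (hPQ : ∀ a b, P a b → Q a b) {k : ℕ} {a c : ν} (h : Pieces P k a c) :
    Pieces Q k a c := by
  induction h with
  | nil k a => exact .nil _ _
  | cons hp _ ih => exact .cons (hPQ _ _ hp) ih

theorem append {k l : ℕ} {a b c : ν} (h : Pieces P k a b) (h' : Pieces P l b c) :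
    Pieces P (k + l) a c := by
  induction h with
  | nil k a => exact h'.mono_count (by omega)
  | @cons k a b _ hp _ ih =>
    have := Pieces.cons hp (ih h')
    exact this.mono_count (by omega)

theorem single {a b : ν} (h : P a b) : Pieces P 1 a b := .cons h (.nil 0 b)

theorem bind {m : ℕ} (hPQ : ∀ a b, P a b → Pieces Q m a b) {k : ℕ} {a c : ν}
    (h : Pieces P k a c) : Pieces Q (k * m) a c := by
  induction h with
  | nil k a => exact .nil _ _
  | cons hp _ ih => exact ((hPQ _ _ hp).append ih).mono_count (by ring_nf; omega)

theorem le_of {R : ν → ℕ} (hR : ∀ a b, P a b → R a ≤ R b) {k : ℕ} {a c : ν}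
    (h : Pieces P k a c) : R a ≤ R c := by
  induction h with
  | nil k a => exact le_rfl
  | cons hp _ ih => exact (hR _ _ hp).trans ih

theorem bounded {R : ν → ℕ} (hR : ∀ a b, P a b → R a ≤ R b) {k : ℕ} {a c : ν}
    (h : Pieces P k a c) : Pieces (fun x y => P x y ∧ R a ≤ R x ∧ R y ≤ R c) k a c := by
  induction h with
  | nil k a => exact .nil _ _
  | cons hp hq ih =>
    refine .cons ⟨hp, le_rfl, hq.le_of hR⟩ (ih.imp fun x y hxy => ⟨hxy.1, ?_, hxy.2.2⟩)
    exact (hR _ _ hp).trans hxy.2.1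

theorem reflTransGen (hPQ : ∀ a b, P a b → Relation.ReflTransGen Q a b) {k : ℕ} {a c : ν}
    (h : Pieces P k a c) : Relation.ReflTransGen Q a c := by
  induction h with
  | nil k a => exact .refl
  | cons hp _ ih => exact (hPQ _ _ hp).trans ih

end Pieces

/-- A forest given by its parent relation `E a b` (`a` is the parent of `b`), with a potential `R`
that is monotone along the edges. -/
structure WTree (ν : Type) where
  E : ν → ν → Prop
  dep : ν → ℕ
  R : ν → ℕ
  dep_lt : ∀ {a b}, E a b → dep a < dep b
  uniq : ∀ {a a' b}, E a b → E a' b → a = a'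
  R_le : ∀ {a b}, E a b → R a ≤ R b

namespace WTree

variable {ν : Type} (T : WTree ν)

/-- `T.Anc a b`: the node `a` is an ancestor of `b` or equal to `b`. -/
def Anc : ν → ν → Prop := Relation.ReflTransGen T.E

variable {T}

theorem Anc.refl (a : ν) : T.Anc a a := Relation.ReflTransGen.refl

theorem Anc.trans {a b c : ν} (h : T.Anc a b) (h' : T.Anc b c) : T.Anc a c :=
  Relation.ReflTransGen.trans h h'

theorem Anc.of_edge {a b : ν} (h : T.E a b) : T.Anc a b := Relation.ReflTransGen.single h

theorem Anc.dep_le {a b : ν} (h : T.Anc a b) : T.dep a ≤ T.dep b := by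
  induction h with
  | refl => exact le_rfl
  | tail _ h ih => exact ih.trans (T.dep_lt h).le

theorem Anc.R_le {a b : ν} (h : T.Anc a b) : T.R a ≤ T.R b := by
  induction h with
  | refl => exact le_rfl
  | tail _ h ih => exact ih.trans (T.R_le h)

theorem Anc.eq_or_parent {a b : ν} (h : T.Anc a b) : a = b ∨ ∃ u, T.E u b ∧ T.Anc a u := by
  rcases Relation.ReflTransGen.cases_tail h with h | ⟨u, h1, h2⟩
  · exact .inl h.symm
  · exact .inr ⟨u, h2, h1⟩

theorem Anc.parent_of_ne {a b u : ν} (h : T.Anc a b) (hne : a ≠ b) (hu : T.E u b) :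
    T.Anc a u := by
  obtain ⟨u', h1, h2⟩ := h.eq_or_parent.resolve_left hne
  rwa [T.uniq hu h1]

theorem Anc.dep_lt {a b : ν} (h : T.Anc a b) (hne : a ≠ b) : T.dep a < T.dep b := by
  obtain ⟨u, h1, h2⟩ := h.eq_or_parent.resolve_left hne
  exact h2.dep_le.trans_lt (T.dep_lt h1)

theorem Anc.antisymm {a b : ν} (h : T.Anc a b) (h' : T.Anc b a) : a = b := by
  by_contra hne
  exact absurd (h.dep_lt hne) (not_lt.2 h'.dep_le)

variable (T)

/-- A step along an edge, or along a segment of `F` that weighs at most `W / 2`. -/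
def Light (F : Finset (ν × ν)) (W : ℕ) (a b : ν) : Prop :=
  T.E a b ∨ (a, b) ∈ F ∧ T.Anc a b ∧ 2 * (T.R b - T.R a) ≤ W

/-- A step along an edge, or along a segment of `F` that weighs at most `M`. -/
def Step (F : Finset (ν × ν)) (M : ℕ) (a b : ν) : Prop :=
  T.E a b ∨ (a, b) ∈ F ∧ T.Anc a b ∧ T.R b - T.R a ≤ M

/-- A step along an edge or along a segment of `F`. -/
def Hop (F : Finset (ν × ν)) (a b : ν) : Prop := T.E a b ∨ (a, b) ∈ F ∧ T.Anc a b

/-- Every segment in `F` splits into at most `c` edges and segments of `F` of at most half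
its weight. -/
def Closed (c : ℕ) (F : Finset (ν × ν)) : Prop :=
  ∀ a b, (a, b) ∈ F → T.Anc a b ∧ Pieces (T.Light F (T.R b - T.R a)) c a b

variable {T}

theorem Light.mono {F F' : Finset (ν × ν)} (hF : F ⊆ F') {W W' : ℕ} (hW : W ≤ W') (a b : ν)
    (h : T.Light F W a b) : T.Light F' W' a b :=
  h.imp id fun h => ⟨hF h.1, h.2.1, h.2.2.trans hW⟩

theorem Step.mono {F F' : Finset (ν × ν)} (hF : F ⊆ F') {M M' : ℕ} (hM : M ≤ M') (a b : ν)
    (h : T.Step F M a b) : T.Step F' M' a b :=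
  h.imp id fun h => ⟨hF h.1, h.2.1, h.2.2.trans hM⟩

theorem Hop.mono {F F' : Finset (ν × ν)} (hF : F ⊆ F') (a b : ν)
    (h : T.Hop F a b) : T.Hop F' a b :=
  h.imp id fun h => ⟨hF h.1, h.2⟩

theorem Step.hop {F : Finset (ν × ν)} {M : ℕ} (a b : ν) (h : T.Step F M a b) : T.Hop F a b :=
  h.imp id fun h => ⟨h.1, h.2.1⟩

theorem Hop.anc {F : Finset (ν × ν)} (a b : ν) (h : T.Hop F a b) : T.Anc a b :=
  h.elim Anc.of_edge fun h => h.2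

theorem Step.light {F : Finset (ν × ν)} {M W : ℕ} (hW : 2 * M ≤ W) (a b : ν)
    (h : T.Step F M a b) : T.Light F W a b :=
  h.imp id fun h => ⟨h.1, h.2.1, by omega⟩

theorem Closed.mono {c : ℕ} {F F' : Finset (ν × ν)} (h : T.Closed c F) (hF : F ⊆ F') {a b : ν}
    (hab : (a, b) ∈ F) : T.Anc a b ∧ Pieces (T.Light F' (T.R b - T.R a)) c a b :=
  ⟨(h a b hab).1, (h a b hab).2.imp (Light.mono hF le_rfl)⟩

theorem Closed.union [DecidableEq ν] {c : ℕ} {F F' : Finset (ν × ν)} (h : T.Closed c F)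
    (h' : T.Closed c F') : T.Closed c (F ∪ F') := by
  intro a b hab
  rcases Finset.mem_union.1 hab with hab | hab
  · exact h.mono Finset.subset_union_left hab
  · exact h'.mono Finset.subset_union_right hab

theorem Closed.insert [DecidableEq ν] {c : ℕ} {F : Finset (ν × ν)} (h : T.Closed c F) {a b : ν}
    (hab : T.Anc a b) (hp : Pieces (T.Light F (T.R b - T.R a)) c a b) :
    T.Closed c (insert (a, b) F) := by
  intro a' b' hab'
  rcases Finset.mem_insert.1 hab' with h' | h'
  · obtain ⟨rfl, rfl⟩ := Prod.mk.inj h'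
    exact ⟨hab, hp.imp (Light.mono (Finset.subset_insert _ _) le_rfl)⟩
  · exact h.mono (Finset.subset_insert _ _) h'

/-- Every hop splits into light steps with respect to any larger weight. -/
theorem Hop.light {c W : ℕ} (hc : 1 ≤ c) {F F' : Finset (ν × ν)} (hF : T.Closed c F)
    (hsub : F ⊆ F') {a b : ν} (h : T.Hop F a b) (hW : T.R b - T.R a ≤ W) :
    Pieces (T.Light F' W) c a b := by
  rcases h with h | h
  · exact (Pieces.single (.inl h)).mono_count hc
  · exact (hF.mono hsub h.1).2.imp (Light.mono subset_rfl hW)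

/-! ### Decomposition of clusters -/

/-- A cluster rooted at `s`: a set of nodes closed under taking parents, up to `s`, which is not
itself a member. -/
structure IsCluster (T : WTree ν) (s : ν) (K : Finset ν) : Prop where
  root_notMem : s ∉ K
  parent : ∀ v ∈ K, ∃ u, T.E u v ∧ (u = s ∨ u ∈ K)

section Classical

open Classical

variable (T) in
/-- The members of `K` that are equal to `p` or descendants of `p`. -/
noncomputable def below (K : Finset ν) (p : ν) : Finset ν := K.filter fun v => T.Anc p v

variable (T) in
/-- The members of `K` that are neither equal to `p` nor descendants of `p`. -/
noncomputable def cutTop (K : Finset ν) (p : ν) : Finset ν := K.filter fun v => ¬T.Anc p v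

variable (T) in
/-- The members of `K` that are proper descendants of `p`. -/
noncomputable def cutBot (K : Finset ν) (p : ν) : Finset ν :=
  K.filter fun v => T.Anc p v ∧ v ≠ p

section cut

variable {s p : ν} {K : Finset ν}

theorem IsCluster.anc (hK : T.IsCluster s K) {v : ν} (hv : v ∈ K) : T.Anc s v := by
  induction h : T.dep v using Nat.strong_induction_on generalizing v with
  | _ d ih =>
    obtain ⟨u, hu, rfl | hu'⟩ := hK.parent v hv
    · exact .of_edge hu
    · exact (ih _ (h ▸ T.dep_lt hu) hu' rfl).trans (.of_edge hu)

theorem card_cutTop_add_card_below : (T.cutTop K p).card + (T.below K p).card = K.card := by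
  rw [add_comm]
  exact Finset.card_filter_add_card_filter_not _

theorem card_cutBot_add_one (hp : p ∈ K) : (T.cutBot K p).card + 1 = (T.below K p).card := by
  have : T.cutBot K p = (T.below K p).erase p := by
    ext v
    simp only [cutBot, below, Finset.mem_filter, Finset.mem_erase]
    tauto
  rw [this, Finset.card_erase_add_one]
  simp [below, hp, Anc.refl]

theorem IsCluster.top (hK : T.IsCluster s K) : T.IsCluster s (T.cutTop K p) where
  root_notMem h := hK.root_notMem (Finset.mem_filter.1 h).1
  parent v hv := by
    obtain ⟨hv, hpv⟩ := Finset.mem_filter.1 hv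
    obtain ⟨u, hu, h⟩ := hK.parent v hv
    exact ⟨u, hu, h.imp id fun h => Finset.mem_filter.2 ⟨h, fun h' => hpv (h'.trans (.of_edge hu))⟩⟩

theorem IsCluster.bot (hK : T.IsCluster s K) (hp : p ∈ K) : T.IsCluster p (T.cutBot K p) where
  root_notMem h := (Finset.mem_filter.1 h).2.2 rfl
  parent v hv := by
    obtain ⟨hv, hpv, hne⟩ := Finset.mem_filter.1 hv
    obtain ⟨u, hu, h⟩ := hK.parent v hv
    have hpu : T.Anc p u := hpv.parent_of_ne hne.symm hu
    refine ⟨u, hu, ?_⟩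
    by_cases hup : u = p
    · exact .inl hup
    refine .inr (Finset.mem_filter.2 ⟨h.resolve_left ?_, hpu, hup⟩)
    rintro rfl
    exact hK.root_notMem ((hK.anc hp).antisymm hpu ▸ hp)

theorem mem_cutTop_of_edge (hK : T.IsCluster s K) {y : ν} (hp : p ∈ K) (hy : T.E y p) :
    y = s ∨ y ∈ T.cutTop K p := by
  obtain ⟨u, hu, h⟩ := hK.parent p hp
  obtain rfl := T.uniq hu hy
  exact h.imp id fun h => Finset.mem_filter.2
    ⟨h, fun h' => absurd h'.dep_le (not_le.2 (T.dep_lt hy))⟩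

theorem mem_cutBot {z : ν} (hz : z ∈ K) (h : T.Anc p z) : z = p ∨ z ∈ T.cutBot K p := by
  by_cases hzp : z = p
  · exact .inl hzp
  · exact .inr (Finset.mem_filter.2 ⟨hz, h, hzp⟩)

theorem card_cut (hp : p ∈ K) : (T.cutTop K p).card + (T.cutBot K p).card + 1 = K.card := by
  rw [add_assoc, card_cutBot_add_one hp, card_cutTop_add_card_below]

end cut

/-- A decomposition of the cluster `K` rooted at `s` with spine from `s` to `z`: a hop tree with
parent function `π` and ranks `r` below `B`, witnessed by the domains `D`, whose hops use the
segments in `H`. The spine consists of at most `k` steps of weight at most `M`, and `j` further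
segments may be afforded. -/
structure IsDec (T : WTree ν) (s z : ν) (K : Finset ν) (B M k j : ℕ) (π : ν → ν) (r : ν → ℕ)
    (D : ν → Finset ν) (H : Finset (ν × ν)) : Prop where
  parent : ∀ v ∈ K, π v = s ∨ π v ∈ K ∧ r v < r (π v)
  rank_lt : ∀ v ∈ K, r v < B
  mem_dom : ∀ v ∈ K, v ∈ D v
  dom_subset : ∀ v ∈ K, D v ⊆ K
  rank_le : ∀ v ∈ K, r v ≤ 4 * (D v).card.size + 4
  disjoint : ∀ v ∈ K, ∀ v' ∈ K, v ≠ v' → r v = r v' → Disjoint (D v) (D v')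
  hop : ∀ v ∈ K, Pieces (T.Hop H) 5 (π v) v
  closed : T.Closed 9 H
  card_le : H.card + j ≤ K.card
  spine : Pieces (T.Step H M) k s z

/-- Existence of a decomposition, see `WTree.IsDec`. -/
def Dec (T : WTree ν) (s z : ν) (K : Finset ν) (B M k j : ℕ) : Prop :=
  ∃ π r D H, T.IsDec s z K B M k j π r D H

section dec

variable {s z : ν} {K : Finset ν} {B M k j : ℕ}

theorem Dec.mono (h : T.Dec s z K B M k j) {B' M' k' j' : ℕ} (hB : B ≤ B') (hM : M ≤ M')
    (hk : k ≤ k') (hj : j' ≤ j) : T.Dec s z K B' M' k' j' := by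
  obtain ⟨π, r, D, H, h⟩ := h
  exact ⟨π, r, D, H, { h with
    rank_lt := fun v hv => (h.rank_lt v hv).trans_le hB
    card_le := by have := h.card_le; omega
    spine := (h.spine.imp (Step.mono subset_rfl hM)).mono_count hk }⟩

theorem Dec.forget (h : T.Dec s z K B M k j) (M' : ℕ) : T.Dec s s K B M' 0 0 := by
  obtain ⟨π, r, D, H, h⟩ := h
  exact ⟨π, r, D, H, { h with
    card_le := by have := h.card_le; omega
    spine := .nil 0 s }⟩

theorem Dec.empty (s : ν) (B M : ℕ) : T.Dec s s ∅ B M 0 0 :=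
  ⟨id, 0, fun _ => ∅, ∅, by constructor <;> simp [Closed, Pieces.nil]⟩

/-- Closing up the spine of a decomposition with a single new segment. -/
theorem Dec.close (h : T.Dec s z K B M 9 1) (hsz : T.Anc s z) (hM : 2 * M ≤ T.R z - T.R s) :
    T.Dec s z K B (T.R z - T.R s) 1 0 := by
  obtain ⟨π, r, D, H, h⟩ := h
  refine ⟨π, r, D, insert (s, z) H, { h with
    hop := fun v hv => (h.hop v hv).imp (Hop.mono (Finset.subset_insert _ _))
    closed := h.closed.insert hsz (h.spine.imp (Step.light hM))
    card_le := (Finset.card_insert_le _ _).trans h.card_le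
    spine := .single (.inr ⟨Finset.mem_insert_self _ _, hsz, le_rfl⟩) }⟩

/-- The function that is `f` on `K`, `x` at `p` and `g` elsewhere. -/
noncomputable def glue {α : Type} (K : Finset ν) (p : ν) (f : ν → α) (x : α) (g : ν → α) (v : ν) :
    α :=
  if v ∈ K then f v else if v = p then x else g v

theorem glue_left {α : Type} {p : ν} {f : ν → α} {x : α} {g : ν → α} {v : ν} (hv : v ∈ K) :
    glue K p f x g v = f v := if_pos hv

theorem glue_mid {α : Type} {p : ν} {f : ν → α} {x : α} {g : ν → α} (hp : p ∉ K) :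
    glue K p f x g p = x := by simp [glue, hp]

theorem glue_right {α : Type} {p : ν} {f : ν → α} {x : α} {g : ν → α} {v : ν} (hv : v ∉ K)
    (hvp : v ≠ p) : glue K p f x g v = g v := by simp [glue, hv, hvp]

/-- Combining decompositions of the two parts of a cluster that is cut at `p`. -/
theorem Dec.combine {y p : ν} {B₁ B₂ k₁ k₂ : ℕ} (hp : p ∈ K)
    (h₁ : T.Dec s y (T.cutTop K p) B₁ M k₁ 0) (hy : T.E y p)
    (h₂ : T.Dec p z (T.cutBot K p) B₂ M k₂ 0) (hk : k₁ + 1 ≤ 5)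
    (hB : B₂ ≤ 4 * (T.below K p).card.size + 4) :
    T.Dec s z K (max B₁ (B₂ + 1)) M (k₁ + k₂ + 1) 1 := by
  obtain ⟨π₁, r₁, D₁, H₁, h₁⟩ := h₁
  obtain ⟨π₂, r₂, D₂, H₂, h₂⟩ := h₂
  have hcard := card_cut (T := T) hp
  have hpt : p ∉ T.cutTop K p := fun h => (Finset.mem_filter.1 h).2 (.refl p)
  have hcases : ∀ v ∈ K, v ∈ T.cutTop K p ∨ v = p ∨
      v ∈ T.cutBot K p ∧ v ∉ T.cutTop K p ∧ v ≠ p := by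
    intro v hv
    simp only [cutTop, cutBot, Finset.mem_filter]
    tauto
  have htop : T.cutTop K p ⊆ K := Finset.filter_subset _ _
  have hbot : T.cutBot K p ⊆ K := Finset.filter_subset _ _
  have hbelow : T.below K p ⊆ K := Finset.filter_subset _ _
  have hbb : T.cutBot K p ⊆ T.below K p := fun v hv => by
    simp only [cutBot, below, Finset.mem_filter] at hv ⊢
    tauto
  have hdis : Disjoint (T.cutTop K p) (T.below K p) :=
    (Finset.disjoint_filter_filter_not _ _ _).symm
  have hdis' : ∀ v ∈ T.cutBot K p, v ∉ T.cutTop K p := fun v hv hv' =>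
    Finset.disjoint_left.1 hdis hv' (hbb hv)
  have hne : ∀ v ∈ T.cutBot K p, v ≠ p := fun v hv => (Finset.mem_filter.1 hv).2.2
  let π := glue (T.cutTop K p) p π₁ s π₂
  let r := glue (T.cutTop K p) p r₁ B₂ r₂
  let D := glue (T.cutTop K p) p D₁ (T.below K p) D₂
  have hr : ∀ v ∈ T.cutBot K p, r v = r₂ v := fun v hv => glue_right (hdis' v hv) (hne v hv)
  refine ⟨π, r, D, H₁ ∪ H₂, ?_, ?_, ?_, ?_, ?_, ?_, ?_, h₁.closed.union h₂.closed, ?_, ?_⟩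
  · intro v hv
    rcases hcases v hv with h | rfl | ⟨h, h', h''⟩
    · simp only [π, r, glue_left h]
      rcases h₁.parent v h with h3 | ⟨h3, h4⟩
      · exact .inl h3
      · exact .inr ⟨htop h3, by rwa [glue_left h3]⟩
    · exact .inl (glue_mid hpt)
    · right
      simp only [π, hr v h, glue_right h' h'']
      rcases h₂.parent v h with h3 | ⟨h3, h4⟩
      · rw [h3]
        exact ⟨hp, (h₂.rank_lt v h).trans_eq (glue_mid hpt).symm⟩
      · exact ⟨hbot h3, by rwa [hr _ h3]⟩
  · intro v hv
    rcases hcases v hv with h | rfl | ⟨h, h', h''⟩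
    · simp only [r, glue_left h]
      exact (h₁.rank_lt v h).trans_le (le_max_left _ _)
    · simp only [r, glue_mid hpt]
      omega
    · rw [hr v h]
      have := h₂.rank_lt v h
      omega
  · intro v hv
    rcases hcases v hv with h | rfl | ⟨h, h', h''⟩
    · simpa only [D, glue_left h] using h₁.mem_dom v h
    · simp only [D, glue_mid hpt]
      exact Finset.mem_filter.2 ⟨hp, .refl v⟩
    · simpa only [D, glue_right h' h''] using h₂.mem_dom v h
  · intro v hv
    rcases hcases v hv with h | rfl | ⟨h, h', h''⟩
    · simpa only [D, glue_left h] using (h₁.dom_subset v h).trans htop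
    · simpa only [D, glue_mid hpt] using hbelow
    · simpa only [D, glue_right h' h''] using (h₂.dom_subset v h).trans hbot
  · intro v hv
    rcases hcases v hv with h | rfl | ⟨h, h', h''⟩
    · simpa only [r, D, glue_left h] using h₁.rank_le v h
    · simpa only [r, D, glue_mid hpt] using hB
    · simpa only [r, D, glue_right h' h''] using h₂.rank_le v h
  · intro v hv v' hv' hvv hrr
    rcases hcases v hv with h | rfl | ⟨h, h', h''⟩ <;>
      rcases hcases v' hv' with g | rfl | ⟨g, g', g''⟩
    · simp only [r, D, glue_left h, glue_left g] at hrr ⊢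
      exact h₁.disjoint v h v' g hvv hrr
    · simp only [D, glue_left h, glue_mid hpt]
      exact hdis.mono_left (h₁.dom_subset v h)
    · simp only [D, glue_left h, glue_right g' g'']
      exact hdis.mono (h₁.dom_subset v h) ((h₂.dom_subset v' g).trans hbb)
    · simp only [D, glue_left g, glue_mid hpt]
      exact (hdis.mono_left (h₁.dom_subset v' g)).symm
    · exact absurd rfl hvv
    · simp only [r, glue_mid hpt, glue_right g' g''] at hrr
      exact absurd hrr (h₂.rank_lt v' g).ne'
    · simp only [D, glue_left g, glue_right h' h'']
      exact (hdis.mono (h₁.dom_subset v' g) ((h₂.dom_subset v h).trans hbb)).symm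
    · simp only [r, glue_mid hpt, glue_right h' h''] at hrr
      exact absurd hrr (h₂.rank_lt v h).ne
    · simp only [r, D, glue_right h' h'', glue_right g' g''] at hrr ⊢
      exact h₂.disjoint v h v' g hvv hrr
  · intro v hv
    rcases hcases v hv with h | rfl | ⟨h, h', h''⟩
    · simp only [π, glue_left h]
      exact (h₁.hop v h).imp (Hop.mono Finset.subset_union_left)
    · simp only [π, glue_mid hpt]
      refine Pieces.mono_count (.append (h₁.spine.imp fun a b hab => ?_) (.single (.inl hy))) hk
      exact Hop.mono Finset.subset_union_left _ _ hab.hop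
    · simp only [π, glue_right h' h'']
      exact (h₂.hop v h).imp (Hop.mono Finset.subset_union_right)
  · have := Finset.card_union_le H₁ H₂
    have := h₁.card_le
    have := h₂.card_le
    omega
  · refine ((h₁.spine.imp (Step.mono Finset.subset_union_left le_rfl)).append
      (.cons (.inl hy) (h₂.spine.imp (Step.mono Finset.subset_union_right le_rfl)))).mono_count ?_
    omega

end dec

section recursion

variable {s z : ν} {K : Finset ν}

/-- Clusters of size at most `h` have decompositions. -/
def DecBelow (T : WTree ν) (h : ℕ) : Prop :=
  ∀ s K, T.IsCluster s K → K.card ≤ h → ∀ M, T.Dec s s K (4 * K.card.size) M 0 0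

/-- Clusters of size at most `h` have decompositions with any spine of a single step. -/
def SpineDecBelow (T : WTree ν) (h : ℕ) : Prop :=
  ∀ s z K, T.IsCluster s K → K.card ≤ h → z = s ∨ z ∈ K → ∀ M, T.R z - T.R s ≤ M →
    T.Dec s z K (4 * K.card.size + 2) M 1 0

theorem size_half {n : ℕ} (hn : 1 ≤ n) : n.size = (n / 2).size + 1 := by
  refine le_antisymm (Nat.size_le.2 ?_) (Nat.lt_size.2 ?_)
  · have := Nat.lt_size_self (n / 2)
    rw [pow_succ]
    omega
  · rcases Nat.eq_zero_or_pos (n / 2) with h | h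
    · simpa [h] using hn
    · obtain ⟨m, hm⟩ : ∃ m, (n / 2).size = m + 1 :=
        ⟨(n / 2).size - 1, by have := Nat.size_pos.2 h; omega⟩
      have := Nat.lt_size.1 (show m < (n / 2).size by omega)
      rw [hm, pow_succ]
      omega

theorem below_mono {K' : Finset ν} (h : K' ⊆ K) (p : ν) : T.below K' p ⊆ T.below K p :=
  Finset.filter_subset_filter _ h

theorem cutTop_mono {K' : Finset ν} (h : K' ⊆ K) (p : ν) : T.cutTop K' p ⊆ T.cutTop K p :=
  Finset.filter_subset_filter _ h

theorem cutTop_subset (K : Finset ν) (p : ν) : T.cutTop K p ⊆ K := Finset.filter_subset _ _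

theorem cutBot_subset (K : Finset ν) (p : ν) : T.cutBot K p ⊆ K := Finset.filter_subset _ _

/-- Decomposition of a cluster in which all subtrees are small. -/
theorem Dec.star {h : ℕ} (hU : T.DecBelow h) (hK : T.IsCluster s K)
    (hbelow : ∀ v ∈ K, (T.below K v).card ≤ h) (M : ℕ) :
    T.Dec s s K (4 * h.size + 1) M 0 0 := by
  induction hn : K.card using Nat.strong_induction_on generalizing K with
  | _ n ih =>
    rcases K.eq_empty_or_nonempty with rfl | hne
    · exact .empty _ _ _
    obtain ⟨p, hp, hmin⟩ := K.exists_min_image T.dep hne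
    have hcard := card_cut (T := T) hp
    obtain ⟨u, hu, hus⟩ := hK.parent p hp
    obtain rfl : u = s := hus.resolve_right fun h =>
      absurd (hmin u h) (not_le.2 (T.dep_lt hu))
    have hb := card_cutBot_add_one (T := T) hp
    have h1 := ih _ (by omega) (hK.top (p := p))
      (fun v hv => (Finset.card_le_card (below_mono (cutTop_subset K p) v)).trans
        (hbelow v (cutTop_subset K p hv))) rfl
    have h2 := hU p _ (hK.bot hp) (by have := hbelow p hp; omega) M
    have hs1 := Nat.size_le_size (show (T.cutBot K p).card ≤ h by have := hbelow p hp; omega)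
    have hs2 := Nat.size_le_size (show (T.cutBot K p).card ≤ (T.below K p).card by omega)
    exact ((h1.combine hp hu h2 (by omega) (by omega)).forget M).mono (by omega) le_rfl le_rfl
      le_rfl

theorem Dec.of_half {n : ℕ} (hn : 1 ≤ n) (hU : T.DecBelow (n / 2)) (hM : T.SpineDecBelow (n / 2))
    (hK : T.IsCluster s K) (hKn : K.card = n) (M : ℕ) : T.Dec s s K (4 * n.size) M 0 0 := by
  have hsize := size_half hn
  by_cases hbelow : ∀ v ∈ K, (T.below K v).card ≤ n / 2
  · exact (Dec.star hU hK hbelow M).mono (by omega) le_rfl le_rfl le_rfl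
  push Not at hbelow
  have hne : (K.filter fun v => n / 2 < (T.below K v).card).Nonempty := by
    obtain ⟨v, hv, h⟩ := hbelow
    exact ⟨v, Finset.mem_filter.2 ⟨hv, h⟩⟩
  obtain ⟨p, hp, hmax⟩ := Finset.exists_max_image _ T.dep hne
  obtain ⟨hp, hpb⟩ := Finset.mem_filter.1 hp
  obtain ⟨y, hy, -⟩ := hK.parent p hp
  have hcard := card_cutTop_add_card_below (T := T) (K := K) (p := p)
  have hcard' := card_cutBot_add_one (T := T) hp
  have h1 := hM s y _ (hK.top (p := p)) (by omega) (mem_cutTop_of_edge hK hp hy)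
    (T.R y - T.R s) le_rfl
  have h2 := Dec.star hU (hK.bot hp) (fun v hv => by
    refine (Finset.card_le_card (below_mono (cutBot_subset K p) v)).trans ?_
    by_contra! hlt
    have h3 := hmax v (Finset.mem_filter.2 ⟨cutBot_subset K p hv, hlt⟩)
    have h4 := (Finset.mem_filter.1 hv).2
    exact absurd (h4.1.dep_lt h4.2.symm) (not_lt.2 h3)) (T.R y - T.R s)
  have hs1 := Nat.size_le_size (show (T.cutTop K p).card ≤ n / 2 by omega)
  have hs2 := Nat.size_le_size hpb.le
  exact ((h1.combine hp hy h2 (by omega) (by omega)).forget M).mono (by omega) le_rfl le_rfl le_rfl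

/-- Decomposition with a spine below whose end there are many nodes. -/
theorem Dec.of_heavy {n M : ℕ} (hU : T.DecBelow n) (hM : T.SpineDecBelow (n / 2))
    (hK : T.IsCluster s K) (hKn : K.card ≤ n) (hz : z ∈ K) (htop : (T.cutTop K z).card ≤ n / 2)
    (hW : T.R z - T.R s ≤ M) :
    T.Dec s z K (max (4 * (n / 2).size + 2) (4 * K.card.size + 1)) M 2 0 := by
  obtain ⟨y, hy, -⟩ := hK.parent z hz
  have hcard := card_cut (T := T) hz
  have hcard' := card_cutBot_add_one (T := T) hz
  have hyz := T.R_le hy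
  have h1 := hM s y _ (hK.top (p := z)) htop (mem_cutTop_of_edge hK hz hy) M (by omega)
  have h2 := hU z _ (hK.bot hz) (by omega) M
  have hs1 := Nat.size_le_size htop
  have hs2 := Nat.size_le_size (show (T.cutBot K z).card ≤ K.card by omega)
  have hs3 := Nat.size_le_size (show (T.cutBot K z).card ≤ (T.below K z).card by omega)
  exact (h1.combine hz hy h2 (by omega) (by omega)).mono (by omega) le_rfl le_rfl (by omega)

theorem exists_light_on_spine {h : ℕ} (hK : T.IsCluster s K) (hz : z ∈ K)
    (hzb : (T.below K z).card ≤ h) :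
    ∃ q p, T.E q p ∧ p ∈ K ∧ T.Anc p z ∧ (T.below K p).card ≤ h ∧
      (q = s ∨ q ∈ K ∧ h < (T.below K q).card) := by
  induction hd : T.dep z using Nat.strong_induction_on generalizing z with
  | _ d ih =>
    obtain ⟨u, hu, hus⟩ := hK.parent z hz
    rcases hus with rfl | hus
    · exact ⟨u, z, hu, hz, .refl z, hzb, .inl rfl⟩
    by_cases hub : (T.below K u).card ≤ h
    · obtain ⟨q, p, h1, h2, h3, h4⟩ := ih _ (hd ▸ T.dep_lt hu) hus hub rfl
      exact ⟨q, p, h1, h2, h3.trans (.of_edge hu), h4⟩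
    · exact ⟨u, z, hu, hz, .refl z, hzb, .inr ⟨hus, by omega⟩⟩

/-- Decomposition with a spine of at most four steps. -/
theorem Dec.of_spine {n M : ℕ} (hn : 1 ≤ n) (hU : T.DecBelow n) (hM : T.SpineDecBelow (n / 2))
    (hK : T.IsCluster s K) (hKn : K.card ≤ n) (hz : z = s ∨ z ∈ K) (hW : T.R z - T.R s ≤ M) :
    ∃ B, B ≤ 4 * K.card.size + 3 ∧ B ≤ 4 * n.size + 1 ∧ T.Dec s z K B M 4 0 := by
  have hsize := size_half hn
  by_cases hKh : K.card ≤ n / 2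
  · have := Nat.size_le_size hKh
    exact ⟨_, by omega, by omega, (hM s z K hK hKh hz M hW).mono le_rfl le_rfl (by omega) le_rfl⟩
  have hs1 := Nat.size_le_size hKn
  have hs2 := Nat.size_le_size (not_le.1 hKh).le
  rcases hz with rfl | hz
  · exact ⟨_, by omega, by omega, (hU z K hK hKn M).mono le_rfl le_rfl (by omega) le_rfl⟩
  have htop : ∀ q, n / 2 < (T.below K q).card → (T.cutTop K q).card ≤ n / 2 := fun q hq => by
    have := card_cutTop_add_card_below (T := T) (K := K) (p := q)
    omega
  by_cases hzb : n / 2 < (T.below K z).card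
  · exact ⟨_, by omega, by omega, (Dec.of_heavy hU hM hK hKn hz (htop z hzb) hW).mono le_rfl le_rfl
      (by omega) le_rfl⟩
  obtain ⟨q, p, hqp, hp, hpz, hpb, hq⟩ := exists_light_on_spine hK hz (not_lt.1 hzb)
  have hcard := card_cut (T := T) hp
  have hcard' := card_cutBot_add_one (T := T) hp
  have hs3 := Nat.size_le_size (show (T.cutTop K p).card ≤ K.card by omega)
  have hs4 := Nat.size_le_size (show (T.cutBot K p).card ≤ (T.below K p).card by omega)
  have hs5 := Nat.size_le_size hpb
  have hR1 := T.R_le hqp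
  have hR2 := hpz.R_le
  have hR3 := (hK.anc hp).R_le
  have h1 : T.Dec s q (T.cutTop K p) (max (4 * (n / 2).size + 2) (4 * K.card.size + 1)) M 2 0 := by
    have hqt := mem_cutTop_of_edge hK hp hqp
    rcases hq with rfl | ⟨hq, hqb⟩
    · exact (hU q _ (hK.top (p := p)) (by omega) M).mono (by omega) le_rfl (by omega) le_rfl
    · have hqs : q ≠ s := fun h => hK.root_notMem (h ▸ hq)
      refine (Dec.of_heavy hU hM (hK.top (p := p)) (by omega) (hqt.resolve_left hqs)
        ((Finset.card_le_card (cutTop_mono (cutTop_subset K p) q)).trans (htop q hqb))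
        (by omega)).mono (by omega) le_rfl le_rfl le_rfl
  have h2 := hM p z _ (hK.bot hp) (by omega) (mem_cutBot hz hpz) M (by omega)
  exact ⟨_, by omega, by omega, (h1.combine hp hqp h2 (by omega) (by omega)).mono le_rfl le_rfl
      (by omega) (by omega)⟩

theorem exists_weight_cut {W : ℕ} (hK : T.IsCluster s K) {v : ν} (hv : v ∈ K)
    (hvz : T.Anc v z) (hW : T.R z - T.R s = W) (hvW : 2 * (T.R z - T.R v) ≤ W) :
    ∃ y p, T.E y p ∧ p ∈ K ∧ T.Anc p z ∧ T.R y - T.R s ≤ W / 2 ∧ T.R z - T.R p ≤ W / 2 := by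
  induction hd : T.dep v using Nat.strong_induction_on generalizing v with
  | _ d ih =>
    obtain ⟨u, hu, hus⟩ := hK.parent v hv
    by_cases huW : T.R u - T.R s ≤ W / 2
    · exact ⟨u, v, hu, hv, hvz, huW, by omega⟩
    rcases hus with rfl | hus
    · simp at huW
    · exact ih _ (hd ▸ T.dep_lt hu) hus (.trans (.of_edge hu) hvz) (by omega) rfl

theorem SpineDec.of_half {n M : ℕ} (hn : 1 ≤ n) (hU : T.DecBelow n)
    (hM : T.SpineDecBelow (n / 2)) (hK : T.IsCluster s K) (hKn : K.card = n)
    (hz : z ∈ K) (hW : T.R z - T.R s ≤ M) : T.Dec s z K (4 * n.size + 2) M 1 0 := by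
  obtain ⟨y, p, hy, hp, hpz, h1, h2⟩ :=
    exists_weight_cut hK hz (.refl z) rfl (by simp)
  have hcard := card_cut (T := T) hp
  have hcard' := card_cutBot_add_one (T := T) hp
  have hs4 := Nat.size_le_size (show (T.cutBot K p).card ≤ (T.below K p).card by omega)
  obtain ⟨B₁, -, hB₁, hd₁⟩ := Dec.of_spine hn hU hM (hK.top (p := p)) (by omega)
    (mem_cutTop_of_edge hK hp hy) h1
  obtain ⟨B₂, hB₂', hB₂, hd₂⟩ := Dec.of_spine hn hU hM (hK.bot hp) (by omega)
    (mem_cutBot hz hpz) h2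
  exact ((hd₁.combine hp hy hd₂ (by omega) (by omega)).close (hK.anc hz) (by omega)).mono
    (by omega) hW le_rfl le_rfl

theorem decBelow_and_spineDecBelow (T : WTree ν) (n : ℕ) : T.DecBelow n ∧ T.SpineDecBelow n := by
  induction n using Nat.strong_induction_on with
  | _ n ih =>
    have key : T.DecBelow n := by
      intro s K hK hKn M
      rcases Nat.eq_zero_or_pos K.card with h0 | hpos
      · rw [Finset.card_eq_zero.1 h0]
        exact .empty _ _ _
      · obtain ⟨h1, h2⟩ := ih (K.card / 2) (by omega)
        exact Dec.of_half hpos h1 h2 hK rfl M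
    refine ⟨key, fun s z K hK hKn hz M hW => ?_⟩
    rcases hz with rfl | hz
    · exact (key z K hK hKn M).mono (by omega) le_rfl (by omega) le_rfl
    · have hpos : 1 ≤ K.card := Finset.card_pos.2 ⟨z, hz⟩
      exact SpineDec.of_half hpos (fun s' K' hK' hKn' => key s' K' hK' (by omega))
        (ih (K.card / 2) (by omega)).2 hK rfl hz hW

end recursion

section sum

variable {s z : ν} {K : Finset ν} {B M k j : ℕ} {π : ν → ν} {r : ν → ℕ} {D : ν → Finset ν}
  {H : Finset (ν × ν)}

theorem two_pow_size_le {n : ℕ} (hn : 1 ≤ n) : 2 ^ n.size ≤ 2 * n := by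
  have h := Nat.size_pos.2 hn
  obtain ⟨m, hm⟩ : ∃ m, n.size = m + 1 := ⟨n.size - 1, by omega⟩
  have := Nat.lt_size.1 (show m < n.size by omega)
  rw [hm, pow_succ]
  omega

theorem IsDec.card_rank_eq (h : T.IsDec s z K B M k j π r D H) (i : ℕ) :
    (K.filter fun v => r v = i).card * 2 ^ (i / 4) ≤ 4 * K.card := by
  have h1 : ∀ v ∈ K.filter (fun v => r v = i), 2 ^ (i / 4) ≤ 4 * (D v).card := by
    intro v hv
    obtain ⟨hv, hi⟩ := Finset.mem_filter.1 hv
    have h2 := h.rank_le v hv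
    have h3 := two_pow_size_le (Finset.card_pos.2 ⟨v, h.mem_dom v hv⟩)
    calc 2 ^ (i / 4) ≤ 2 ^ ((D v).card.size + 1) := Nat.pow_le_pow_right (by omega) (by omega)
      _ ≤ 4 * (D v).card := by rw [pow_succ]; omega
  calc (K.filter fun v => r v = i).card * 2 ^ (i / 4)
      = ∑ _v ∈ K.filter (fun v => r v = i), 2 ^ (i / 4) := by rw [Finset.sum_const, smul_eq_mul]
    _ ≤ ∑ v ∈ K.filter (fun v => r v = i), 4 * (D v).card := Finset.sum_le_sum h1
    _ = 4 * ((K.filter fun v => r v = i).biUnion D).card := by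
      rw [← Finset.mul_sum, Finset.card_biUnion]
      intro v hv v' hv' hne
      obtain ⟨hv, hi⟩ := Finset.mem_filter.1 hv
      obtain ⟨hv', hi'⟩ := Finset.mem_filter.1 hv'
      exact h.disjoint v hv v' hv' hne (hi.trans hi'.symm)
    _ ≤ 4 * K.card := Nat.mul_le_mul_left _ (Finset.card_le_card
      (Finset.biUnion_subset.2 fun v hv => h.dom_subset v (Finset.mem_filter.1 hv).1))

theorem IsDec.card_rank_div_eq (h : T.IsDec s z K B M k j π r D H) (i : ℕ) :
    (K.filter fun v => r v / 4 = i).card * 2 ^ i ≤ 16 * K.card := by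
  have hmaps : Set.MapsTo r (K.filter fun v => r v / 4 = i : Finset ν)
      (Finset.Ico (4 * i) (4 * i + 4) : Finset ℕ) := by
    intro v hv
    have := (Finset.mem_filter.1 (Finset.mem_coe.1 hv)).2
    simp only [Finset.coe_Ico, Set.mem_Ico]
    omega
  rw [Finset.card_eq_sum_card_fiberwise hmaps, Finset.sum_mul]
  calc ∑ x ∈ Finset.Ico (4 * i) (4 * i + 4),
        ((K.filter fun v => r v / 4 = i).filter fun v => r v = x).card * 2 ^ i
      ≤ ∑ x ∈ Finset.Ico (4 * i) (4 * i + 4), 4 * K.card := by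
        refine Finset.sum_le_sum fun x hx => le_trans ?_ (h.card_rank_eq x)
        have hx' := Finset.mem_Ico.1 hx
        rw [show x / 4 = i by omega]
        exact Nat.mul_le_mul_right _ (Finset.card_le_card
          (Finset.filter_subset_filter _ (Finset.filter_subset _ _)))
    _ = 16 * K.card := by simp; ring

/-- The average rank in a decomposition is bounded. -/
theorem IsDec.sum_rank_le (h : T.IsDec s z K B M k j π r D H) :
    ∑ v ∈ K, r v ≤ 131 * K.card := by
  have hsum : ∀ t : Finset ℕ, ∑ i ∈ t, (i : ℝ) * (1 / 2) ^ i ≤ 2 := fun t => by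
    have h1 : ‖(1 / 2 : ℝ)‖ < 1 := by norm_num
    have h2 := (hasSum_coe_mul_geometric_of_norm_lt_one h1)
    refine (h2.summable.sum_le_tsum t fun i _ => by positivity).trans ?_
    rw [h2.tsum_eq]
    norm_num
  have hdiv : ∑ v ∈ K, r v / 4 ≤ 32 * K.card := by
    have h1 := Finset.sum_comp (s := K) (fun i : ℕ => (i : ℝ)) (fun v => r v / 4)
    have h2 : ∑ i ∈ K.image (fun v => r v / 4), (K.filter fun v => r v / 4 = i).card • (i : ℝ) ≤
        16 * K.card * ∑ i ∈ K.image (fun v => r v / 4), (i : ℝ) * (1 / 2) ^ i := by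
      rw [Finset.mul_sum]
      refine Finset.sum_le_sum fun i _ => ?_
      have h3 : ((K.filter fun v => r v / 4 = i).card : ℝ) * 2 ^ i ≤ 16 * K.card := by
        exact_mod_cast h.card_rank_div_eq i
      have h4 : ((K.filter fun v => r v / 4 = i).card : ℝ) ≤ 16 * K.card * (1 / 2) ^ i := by
        rw [one_div, inv_pow, ← div_eq_mul_inv]
        exact (le_div_iff₀ (by positivity)).2 h3
      calc (K.filter fun v => r v / 4 = i).card • (i : ℝ)
          = (K.filter fun v => r v / 4 = i).card * (i : ℝ) := by rw [nsmul_eq_mul]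
        _ ≤ (16 * K.card * (1 / 2) ^ i) * i := mul_le_mul_of_nonneg_right h4 (by positivity)
        _ = 16 * K.card * (i * (1 / 2) ^ i) := by ring
    have h5 := mul_le_mul_of_nonneg_left (hsum (K.image fun v => r v / 4))
      (show (0 : ℝ) ≤ 16 * K.card by positivity)
    have h6 : ((∑ v ∈ K, r v / 4 : ℕ) : ℝ) ≤ ((32 * K.card : ℕ) : ℝ) := by
      push_cast
      rw [h1]
      linarith
    exact_mod_cast h6
  calc ∑ v ∈ K, r v ≤ ∑ v ∈ K, (4 * (r v / 4) + 3) := Finset.sum_le_sum fun v _ => by omega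
    _ = 4 * ∑ v ∈ K, r v / 4 + 3 * K.card := by
      rw [Finset.sum_add_distrib, ← Finset.mul_sum, Finset.sum_const, smul_eq_mul, mul_comm 3]
    _ ≤ 131 * K.card := by omega

end sum

/-! ### Topmost ancestors with respect to dyadic grids -/

section top

variable {a b x y : ν} {i i' k : ℕ}

theorem Anc.total (ha : T.Anc a x) (hb : T.Anc b x) : T.Anc a b ∨ T.Anc b a := by
  induction ha with
  | refl => exact .inr hb
  | @tail u v h1 h2 ih =>
    by_cases hne : b = v
    · exact .inl (hne ▸ h1.tail h2)
    · exact ih (hb.parent_of_ne hne h2)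

theorem exists_top (T : WTree ν) (i : ℕ) (x : ν) : ∃ y, T.Anc y x ∧
    T.R y / 2 ^ i = T.R x / 2 ^ i ∧ ∀ u, T.E u y → T.R u / 2 ^ i ≠ T.R x / 2 ^ i := by
  induction hd : T.dep x using Nat.strong_induction_on generalizing x with
  | _ d ih =>
    by_cases h : ∃ u, T.E u x ∧ T.R u / 2 ^ i = T.R x / 2 ^ i
    · obtain ⟨u, hu, hR⟩ := h
      obtain ⟨y, h1, h2, h3⟩ := ih _ (hd ▸ T.dep_lt hu) u rfl
      exact ⟨y, h1.trans (.of_edge hu), h2.trans hR, fun v hv => hR ▸ h3 v hv⟩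
    · exact ⟨x, .refl x, rfl, fun u hu hR => h ⟨u, hu, hR⟩⟩

/-- The topmost ancestor of `x` whose potential lies in the same interval of the grid of width
`2 ^ i` as the potential of `x`. -/
noncomputable def top (T : WTree ν) (i : ℕ) (x : ν) : ν := (T.exists_top i x).choose

theorem top_anc : T.Anc (T.top i x) x := (T.exists_top i x).choose_spec.1

theorem top_div : T.R (T.top i x) / 2 ^ i = T.R x / 2 ^ i := (T.exists_top i x).choose_spec.2.1

theorem div_ne_of_edge_top {u : ν} (hu : T.E u (T.top i x)) :
    T.R u / 2 ^ i ≠ T.R x / 2 ^ i := (T.exists_top i x).choose_spec.2.2 u hu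

theorem top_anc_of_div_eq (hy : T.Anc y x) (h : T.R y / 2 ^ i = T.R x / 2 ^ i) :
    T.Anc (T.top i x) y := by
  refine (top_anc.total hy).elim id fun h' => ?_
  rcases h'.eq_or_parent with rfl | ⟨u, hu, hyu⟩
  · exact .refl _
  · refine absurd ?_ (div_ne_of_edge_top hu)
    refine le_antisymm ?_ (h ▸ Nat.div_le_div_right hyu.R_le)
    exact top_div (T := T) (i := i) (x := x) ▸ Nat.div_le_div_right (T.R_le hu)

theorem top_eq_of_div_eq (hy : T.Anc y x) (h : T.R y / 2 ^ i = T.R x / 2 ^ i) :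
    T.top i y = T.top i x :=
  (top_anc_of_div_eq (top_anc_of_div_eq hy h) (top_div.trans h.symm)).antisymm
    (top_anc_of_div_eq (top_anc.trans hy) (top_div.trans h))

theorem div_two_pow_eq_of_le (hi : i' ≤ i) {m n : ℕ} (h : m / 2 ^ i' = n / 2 ^ i') :
    m / 2 ^ i = n / 2 ^ i := by
  obtain ⟨d, rfl⟩ := Nat.exists_eq_add_of_le hi
  rw [pow_add, ← Nat.div_div_eq_div_mul, h, Nat.div_div_eq_div_mul]

theorem top_anc_top (hi : i' ≤ i) : T.Anc (T.top i x) (T.top i' x) :=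
  top_anc_of_div_eq top_anc (div_two_pow_eq_of_le hi top_div)

variable [Fintype ν]

/-- The topmost ancestors of `x` with respect to the grids of width at least `2 ^ i`. -/
noncomputable def tops (T : WTree ν) (i : ℕ) (x : ν) : Finset ν :=
  Finset.univ.filter fun y => ∃ j, i ≤ j ∧ T.top j x = y

theorem mem_tops : y ∈ T.tops i x ↔ ∃ j, i ≤ j ∧ T.top j x = y := by simp [tops]

theorem tops_eq_of_div_eq (hy : T.Anc y x) (h : T.R y / 2 ^ i = T.R x / 2 ^ i) :
    T.tops i y = T.tops i x := by
  have h' : ∀ j, i ≤ j → T.top j y = T.top j x := fun j hj =>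
    top_eq_of_div_eq hy (div_two_pow_eq_of_le hj h)
  ext z
  simp only [mem_tops]
  exact exists_congr fun j => and_congr_right fun hj => by rw [h' j hj]

theorem div_sandwich {n a b c : ℕ} (hab : a ≤ b) (hbc : b ≤ c) (h : a / n = c / n) :
    b / n = c / n :=
  le_antisymm (Nat.div_le_div_right hbc) (h ▸ Nat.div_le_div_right hab)

/-- Between `top i y` and `y`, at most one new topmost ancestor arises from all grids that are
coarse in comparison with the distance of the two nodes. -/
theorem top_unique {k i' i'' : ℕ} (hw : T.R y - T.R (T.top i y) < 2 ^ k) (h1 : k ≤ i')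
    (h2 : i' ≤ i'') (hi' : T.top i' y ∉ T.tops i y) (hi'' : T.top i'' y ∉ T.tops i y) :
    T.top i'' y = T.top i' y := by
  have key : ∀ j, k ≤ j → T.top j y ∉ T.tops i y →
      T.R y / 2 ^ j = T.R (T.top i y) / 2 ^ j + 1 := by
    intro j hkj hj
    have hji : j ≤ i := by
      by_contra! h
      exact hj (mem_tops.2 ⟨j, h.le, rfl⟩)
    have hle : T.R (T.top i y) ≤ T.R y := top_anc.R_le
    have hne : T.R (T.top i y) / 2 ^ j ≠ T.R y / 2 ^ j := fun h =>
      hj (mem_tops.2 ⟨i, le_rfl, (top_anc_top hji).antisymm (top_anc_of_div_eq top_anc h)⟩)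
    have hlt : T.R y / 2 ^ j ≤ (T.R (T.top i y) + 2 ^ j) / 2 ^ j := by
      have := Nat.pow_le_pow_right (show 0 < 2 by omega) hkj
      exact Nat.div_le_div_right (by omega)
    rw [Nat.add_div_right _ (by positivity)] at hlt
    have := Nat.div_le_div_right (c := 2 ^ j) hle
    omega
  have h3 := key i' h1 hi'
  have h4 := key i'' (h1.trans h2) hi''
  refine (top_anc_top h2).antisymm (top_anc_of_div_eq top_anc ?_)
  have h5 : T.R (T.top i'' y) / 2 ^ i'' = T.R y / 2 ^ i'' := top_div
  have hle : T.R (T.top i'' y) / 2 ^ i' ≤ T.R y / 2 ^ i' := Nat.div_le_div_right top_anc.R_le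
  obtain ⟨d, rfl⟩ := Nat.exists_eq_add_of_le h2
  simp only [pow_add, ← Nat.div_div_eq_div_mul] at h4 h5
  rw [h3, Nat.succ_div] at h4
  have hdvd : 2 ^ d ∣ T.R (T.top i y) / 2 ^ i' + 1 := by
    by_contra h
    simp [h] at h4
  rw [← h3] at hdvd
  refine le_antisymm hle ?_
  calc T.R y / 2 ^ i' = T.R y / 2 ^ i' / 2 ^ d * 2 ^ d := (Nat.div_mul_cancel hdvd).symm
    _ ≤ T.R (T.top (i' + d) y) / 2 ^ i' := by
      rw [← h5]
      exact Nat.div_mul_le_self _ _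

theorem card_tops_le (hw : T.R y - T.R (T.top i y) < 2 ^ (k + 2)) :
    (T.tops k y).card ≤ (T.tops i y).card + 3 := by
  obtain ⟨e, he⟩ : ∃ e, ∀ j, k + 2 ≤ j → T.top j y ∉ T.tops i y → T.top j y = e := by
    by_cases h : ∃ j, k + 2 ≤ j ∧ T.top j y ∉ T.tops i y
    · obtain ⟨j, hj, hj'⟩ := h
      refine ⟨T.top j y, fun l hl hl' => ?_⟩
      rcases le_total j l with hjl | hjl
      · exact top_unique hw hj hjl hj' hl'
      · exact (top_unique hw hl hjl hl' hj').symm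
    · exact ⟨y, fun j hj hj' => absurd ⟨j, hj, hj'⟩ h⟩
  have hsub : T.tops k y ⊆
      insert (T.top k y) (insert (T.top (k + 1) y) (insert e (T.tops i y))) := by
    intro z hz
    obtain ⟨j, hj, rfl⟩ := mem_tops.1 hz
    simp only [Finset.mem_insert]
    obtain rfl | rfl | hj : j = k ∨ j = k + 1 ∨ k + 2 ≤ j := by omega
    · exact .inl rfl
    · exact .inr (.inl rfl)
    · by_cases h : T.top j y ∈ T.tops i y
      · exact .inr (.inr (.inr h))
      · exact .inr (.inr (.inl (he j hj h)))
  refine (Finset.card_le_card hsub).trans ?_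
  have h1 := Finset.card_insert_le (T.top k y) (insert (T.top (k + 1) y) (insert e (T.tops i y)))
  have h2 := Finset.card_insert_le (T.top (k + 1) y) (insert e (T.tops i y))
  have h3 := Finset.card_insert_le e (T.tops i y)
  omega

end top

/-! ### The segments selected in a hop tree -/

/-- A hop tree `P` for `T`: each of its edges consists of at most five hops along the segments of
`H`, and the rank `ρ` strictly decreases along its edges. -/
structure IsHopTree (T P : WTree ν) (ρ : ν → ℕ) (H : Finset (ν × ν)) : Prop where
  R_eq : P.R = T.R
  rank_lt : ∀ a b, P.E a b → ρ b < ρ a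
  hop : ∀ a b, P.E a b → Pieces (T.Hop H) 5 a b
  closed : T.Closed 9 H

section hopTree

variable {P : WTree ν} {ρ : ν → ℕ} {H : Finset (ν × ν)}

theorem IsHopTree.anc (h : T.IsHopTree P ρ H) {a b : ν} (hab : P.Anc a b) : T.Anc a b := by
  induction hab with
  | refl => exact .refl _
  | tail _ he ih => exact ih.trans ((h.hop _ _ he).reflTransGen Hop.anc)

theorem IsHopTree.rank_le (h : T.IsHopTree P ρ H) {a b : ν} (hab : P.Anc a b) : ρ b ≤ ρ a := by
  induction hab with
  | refl => exact le_rfl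
  | tail _ he ih => exact (h.rank_lt _ _ he).le.trans ih

theorem IsHopTree.light (h : T.IsHopTree P ρ H) {a b : ν} (hab : P.E a b) {F : Finset (ν × ν)}
    (hF : H ⊆ F) {W : ℕ} (hW : T.R b - T.R a ≤ W) : Pieces (T.Light F W) 45 a b := by
  have h1 := (h.hop a b hab).bounded (R := T.R) fun _ _ hxy => (Hop.anc _ _ hxy).R_le
  exact h1.bind (m := 9) fun x y hxy => Hop.light (by omega) h.closed hF hxy.1 (by omega)

variable [Fintype ν]

/-- The segments ending in `x` that are selected in the tree `P`. -/
noncomputable def selected (P : WTree ν) (ρ : ν → ℕ) : Finset (ν × ν) :=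
  Finset.univ.filter fun p => ∃ i, P.top i p.2 = p.1 ∧ (P.tops i p.2).card ≤ 3 * ρ p.2 + 1

theorem mem_selected {b x : ν} :
    (b, x) ∈ P.selected ρ ↔ ∃ i, P.top i x = b ∧ (P.tops i x).card ≤ 3 * ρ x + 1 := by
  simp [selected]

theorem card_selected_le (P : WTree ν) (ρ : ν → ℕ) :
    (P.selected ρ).card ≤ ∑ x, (3 * ρ x + 1) := by
  rw [Finset.card_eq_sum_card_fiberwise (f := Prod.snd) (t := Finset.univ) (by simp)]
  refine Finset.sum_le_sum fun x _ => ?_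
  by_cases h : ∃ i, (P.tops i x).card ≤ 3 * ρ x + 1
  · refine (Finset.card_le_card_of_injOn Prod.fst ?_ ?_).trans (Nat.find_spec h)
    · rintro ⟨b, x'⟩ hb
      obtain ⟨hbx, rfl⟩ := Finset.mem_filter.1 hb
      obtain ⟨i, hi, hi'⟩ := mem_selected.1 hbx
      exact mem_tops.2 ⟨i, Nat.find_min' h hi', hi⟩
    · rintro ⟨b, x'⟩ hb ⟨b', x''⟩ hb' hbb
      obtain ⟨-, rfl⟩ := Finset.mem_filter.1 hb
      obtain ⟨-, rfl⟩ := Finset.mem_filter.1 hb'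
      exact Prod.ext hbb rfl
  · rw [Finset.card_eq_zero.2]
    · exact Nat.zero_le _
    · refine Finset.filter_eq_empty_iff.2 ?_
      rintro ⟨b, x'⟩ hb rfl
      obtain ⟨i, -, hi⟩ := mem_selected.1 hb
      exact h ⟨i, hi⟩

theorem root_mem_selected {s x : ν} (hs : ∀ y, P.Anc s y) : (s, x) ∈ P.selected ρ := by
  have htop : ∀ j, P.R x ≤ j → P.top j x = s := fun j hj => by
    have hpow : ∀ y, P.Anc y x → P.R y / 2 ^ j = 0 := fun y hy =>
      Nat.div_eq_of_lt (by have := hy.R_le; have := Nat.lt_two_pow_self (n := j); omega)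
    exact (top_anc_of_div_eq (hs x) ((hpow s (hs x)).trans (hpow x (.refl x)).symm)).antisymm (hs _)
  refine mem_selected.2 ⟨P.R x, htop _ le_rfl, ?_⟩
  have hsub : P.tops (P.R x) x ⊆ {s} := fun y hy => by
    obtain ⟨j, hj, rfl⟩ := mem_tops.1 hy
    exact Finset.mem_singleton.2 (htop j hj)
  have := Finset.card_le_card hsub
  rw [Finset.card_singleton] at this
  omega

theorem IsHopTree.pieces (h : T.IsHopTree P ρ H) {i k m W : ℕ} (hk : 2 * (2 ^ k - 1) ≤ W) (q : ℕ)
    {b y : ν} (hb : P.top i y = b) (hm : (P.tops i y).card ≤ m) (hmy : m + 2 ≤ 3 * ρ y)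
    (hw : P.R y - P.R b < 2 ^ (k + 2)) (hW : P.R y - P.R b ≤ W)
    (hq : P.R y / 2 ^ k ≤ P.R b / 2 ^ k + q) :
    Pieces (T.Light (P.selected ρ ∪ H) W) (q * 46 + 1) b y := by
  induction q generalizing y with
  | zero =>
    have hby : P.Anc b y := hb ▸ top_anc
    refine .mono_count (.single (.inr ⟨?_, h.anc hby, ?_⟩)) (by omega)
    · exact Finset.mem_union_left _ (mem_selected.2 ⟨i, hb, by omega⟩)
    · have h1 := Nat.div_add_mod (P.R y) (2 ^ k)
      have h2 := Nat.div_add_mod (P.R b) (2 ^ k)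
      have h3 := Nat.mod_lt (P.R y) (show 0 < 2 ^ k by positivity)
      have h4 := Nat.mul_le_mul_left (2 ^ k) hq
      rw [← h.R_eq]
      simp only [add_zero] at h4
      omega
  | succ q ih =>
    by_cases hq' : P.R y / 2 ^ k ≤ P.R b / 2 ^ k + q
    · exact (ih hb hm hmy hw hW hq').mono_count (by omega)
    have hki : k ≤ i := by
      by_contra! hlt
      have : P.R b / 2 ^ k = P.R y / 2 ^ k := div_two_pow_eq_of_le hlt.le (hb ▸ top_div)
      omega
    have hbc : P.Anc b (P.top k y) := hb ▸ top_anc_top hki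
    have hcy : P.R (P.top k y) / 2 ^ k = P.R y / 2 ^ k := top_div
    have hne : b ≠ P.top k y := by
      intro hbt
      rw [← hbt] at hcy
      omega
    obtain ⟨d, hd, hbd⟩ := hbc.eq_or_parent.resolve_left hne
    have hca : P.Anc (P.top k y) y := top_anc
    have hda : P.Anc d y := .trans (.of_edge hd) hca
    have hRb := hbd.R_le
    have hRd := P.R_le hd
    have hRc := hca.R_le
    have hdiv : P.R d / 2 ^ i = P.R y / 2 ^ i :=
      div_sandwich hRb hda.R_le (hb ▸ top_div)
    have hdlt : P.R d / 2 ^ k < P.R y / 2 ^ k :=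
      lt_of_le_of_ne (Nat.div_le_div_right hda.R_le) (div_ne_of_edge_top hd)
    have hρ := h.rank_le hda
    have h1 := ih ((top_eq_of_div_eq hda hdiv).trans hb) (tops_eq_of_div_eq hda hdiv ▸ hm)
      (by omega) (by omega) (by omega) (by omega)
    have h2 := h.light hd (F := P.selected ρ ∪ H) (W := W) Finset.subset_union_right
      (by rw [← h.R_eq]; omega)
    have h3 : T.Light (P.selected ρ ∪ H) W (P.top k y) y := by
      refine .inr ⟨Finset.mem_union_left _ (mem_selected.2 ⟨k, rfl, ?_⟩), h.anc hca, ?_⟩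
      · have := card_tops_le (T := P) (k := k) (i := i) (y := y) (by rwa [hb])
        omega
      · have h1 := Nat.div_add_mod (P.R y) (2 ^ k)
        have h2 := Nat.div_add_mod (P.R (P.top k y)) (2 ^ k)
        have h3 := Nat.mod_lt (P.R y) (show 0 < 2 ^ k by positivity)
        rw [hcy] at h2
        rw [← h.R_eq]
        omega
    exact ((h1.append h2).append (.single h3)).mono_count (by omega)

theorem exists_grid (w : ℕ) : ∃ k, w < 2 ^ (k + 2) ∧ 2 * (2 ^ k - 1) ≤ w := by
  rcases lt_or_ge w 4 with hw | hw
  · exact ⟨0, by simpa using hw, by simp⟩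
  · have h1 : 2 ≤ Nat.log 2 w := Nat.le_log_of_pow_le (by omega) (by simpa using hw)
    obtain ⟨k, hk⟩ := Nat.exists_eq_add_of_le' (show 1 ≤ Nat.log 2 w by omega)
    have h2 := Nat.lt_pow_succ_log_self (b := 2) (by omega) w
    have h3 := Nat.pow_log_le_self 2 (show w ≠ 0 by omega)
    rw [hk] at h2 h3
    rw [pow_succ] at h3
    exact ⟨k, h2, by omega⟩

theorem IsHopTree.closed_union (h : T.IsHopTree P ρ H) : T.Closed 230 (P.selected ρ ∪ H) := by
  intro b x hbx
  rcases Finset.mem_union.1 hbx with hb | hb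
  swap
  · have := h.closed.mono (F' := P.selected ρ ∪ H) Finset.subset_union_right hb
    exact ⟨this.1, this.2.mono_count (by omega)⟩
  obtain ⟨i, hi, hcard⟩ := mem_selected.1 hb
  have hanc : P.Anc b x := hi ▸ top_anc
  refine ⟨h.anc hanc, ?_⟩
  rcases hanc.eq_or_parent with rfl | ⟨y, hy, hby⟩
  · exact .nil _ _
  have hRb := hby.R_le
  have hRy := P.R_le hy
  have hdiv : P.R y / 2 ^ i = P.R x / 2 ^ i := div_sandwich hRb hRy (hi ▸ top_div)
  have hρ := h.rank_lt _ _ hy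
  obtain ⟨k, hk, hk'⟩ := exists_grid (P.R y - P.R b)
  rw [← h.R_eq]
  have hq : P.R y / 2 ^ k ≤ P.R b / 2 ^ k + 4 := by
    have h1 : P.R y / 2 ^ k ≤ (P.R b + 4 * 2 ^ k) / 2 ^ k := by
      rw [pow_add] at hk
      exact Nat.div_le_div_right (by omega)
    rwa [Nat.add_mul_div_right _ _ (by positivity)] at h1
  have h1 := h.pieces (W := P.R x - P.R b) (by omega) 4
    ((top_eq_of_div_eq (.of_edge hy) hdiv).trans hi)
    (tops_eq_of_div_eq (.of_edge hy) hdiv ▸ hcard) (by omega) hk (by omega) hq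
  have h2 := h.light hy (F := P.selected ρ ∪ H) (W := P.R x - P.R b) Finset.subset_union_right
    (by rw [← h.R_eq]; omega)
  exact (h1.append h2).mono_count (by omega)

/-- In every tree there is a linear number of segments, including those from the root to all
nodes, such that each of them splits into a bounded number of edges and lighter segments. -/
theorem exists_closed (T : WTree ν) {s : ν} (hs : T.IsCluster s (Finset.univ.erase s)) :
    ∃ F : Finset (ν × ν), F.card ≤ 408 * Fintype.card ν ∧ T.Closed 230 F ∧ ∀ v, (s, v) ∈ F := by
  set K := Finset.univ.erase s with hK
  have hmem : ∀ v, v ≠ s → v ∈ K := fun v hv => Finset.mem_erase.2 ⟨hv, Finset.mem_univ v⟩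
  obtain ⟨π, r, D, H, h⟩ := (T.decBelow_and_spineDecBelow K.card).1 s K hs le_rfl 0
  have hanc : ∀ v ∈ K, T.Anc (π v) v := fun v hv => (h.hop v hv).reflTransGen Hop.anc
  have hne : ∀ v ∈ K, π v ≠ v := fun v hv hπ => by
    rcases h.parent v hv with h' | h'
    · exact hs.root_notMem (h' ▸ hπ.symm ▸ hv)
    · exact absurd h'.2 (by rw [hπ]; exact lt_irrefl _)
  let P : WTree ν :=
    { E := fun a b => b ∈ K ∧ π b = a
      dep := T.dep
      R := T.R
      dep_lt := by
        rintro a b ⟨hb, rfl⟩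
        exact (hanc b hb).dep_lt (hne b hb)
      uniq := by
        rintro a a' b ⟨-, rfl⟩ ⟨-, rfl⟩
        rfl
      R_le := by
        rintro a b ⟨hb, rfl⟩
        exact (hanc b hb).R_le }
  let ρ : ν → ℕ := fun v => if v = s then 4 * K.card.size else r v
  have hρ : ∀ v ∈ K, ρ v = r v := fun v hv => if_neg (Finset.ne_of_mem_erase hv)
  have hP : T.IsHopTree P ρ H :=
    { R_eq := rfl
      rank_lt := by
        rintro a b ⟨hb, rfl⟩
        rw [hρ b hb]
        rcases h.parent b hb with h' | h'
        · simpa [ρ, h'] using h.rank_lt b hb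
        · rw [hρ _ h'.1]
          exact h'.2
      hop := by
        rintro a b ⟨hb, rfl⟩
        exact h.hop b hb
      closed := h.closed }
  have hPs : P.IsCluster s K :=
    { root_notMem := hs.root_notMem
      parent := fun v hv => ⟨π v, ⟨hv, rfl⟩, (h.parent v hv).imp id And.left⟩ }
  have hroot : ∀ v, P.Anc s v := fun v => by
    rcases eq_or_ne v s with rfl | hv
    · exact .refl _
    · exact hPs.anc (hmem v hv)
  refine ⟨P.selected ρ ∪ H, ?_, hP.closed_union,
    fun v => Finset.mem_union_left _ (root_mem_selected hroot)⟩
  have hcard : K.card + 1 = Fintype.card ν := Finset.card_erase_add_one (Finset.mem_univ s)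
  have hsize : K.card.size ≤ K.card := Nat.size_le.2 Nat.lt_two_pow_self
  have h1 := card_selected_le P ρ
  have h2 := h.sum_rank_le
  have h3 : ∑ x, (3 * ρ x + 1) = 3 * (4 * K.card.size + ∑ v ∈ K, r v) + Fintype.card ν := by
    rw [Finset.sum_add_distrib, ← Finset.mul_sum, ← Finset.add_sum_erase _ _ (Finset.mem_univ s),
      ← hK, Finset.sum_congr rfl hρ]
    simp [ρ]
  have h4 := Finset.card_union_le (P.selected ρ) H
  have h5 := h.card_le
  omega

end hopTree

end Classical

end WTree

/-! ### From segments to straight-line programs -/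

section slp

theorem wstr_append {Γ : Type} (w : Γ → ℕ) (s t : List Γ) :
    wstr w (s ++ t) = wstr w s + wstr w t := by simp [wstr]

theorem wstr_pos {Γ : Type} {w : Γ → ℕ} (hw : ∀ a, 0 < w a) {s : List Γ} (hs : s ≠ []) :
    0 < wstr w s := by
  obtain ⟨a, t, rfl⟩ := List.exists_cons_of_ne_nil hs
  simpa [wstr] using Nat.add_pos_left (hw a) _

/-- Substitution of strings for the variables in a string of variables and terminals. -/
def expand {V Γ : Type} (f : V → List Γ) (L : List (V ⊕ Γ)) : List Γ :=
  L.flatMap (Sum.elim f fun a => [a])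

theorem expand_append {V Γ : Type} (f : V → List Γ) (L L' : List (V ⊕ Γ)) :
    expand f (L ++ L') = expand f L ++ expand f L' := List.flatMap_append

theorem expand_map_inr {V Γ : Type} (f : V → List Γ) (s : List Γ) :
    expand f (s.map Sum.inr) = s := by
  simp [expand, List.flatMap_map]

theorem SLP.val_eq_expand {V Γ : Type} (G : SLP V Γ) (A : V) :
    G.val A = expand G.val (G.rhs A) := by
  rw [SLP.val, expand, List.flatMap_def,
    ← List.attach_map_val (l := G.rhs A) (f := Sum.elim G.val fun a => [a])]
  congr 1
  refine List.map_congr_left fun β _ => ?_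
  obtain ⟨B | a, h⟩ := β <;> rfl

/-- A family of strings each of which is composed of few terminals and strings of the family of at
most half its weight is derived by a contracting straight-line program. -/
theorem exists_slp {V Γ : Type} [Nonempty V] {w : Γ → ℕ} (hw : ∀ a, 0 < w a) (f : V → List Γ)
    {m : ℕ} (hf : ∀ A, ∃ L : List (V ⊕ Γ), L.length ≤ m ∧
      (∀ B, Sum.inl B ∈ L → 2 * wstr w (f B) ≤ wstr w (f A)) ∧ expand f L = f A) :
    ∃ G : SLP V Γ, (∀ A, (G.rhs A).length ≤ m) ∧ G.Contracting w ∧ ∀ A, G.val A = f A := by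
  classical
  choose L hlen hweight hexp using hf
  let G : SLP V Γ :=
    { rhs := fun A => if f A = [] then [] else L A
      rank := fun A => wstr w (f A)
      rank_lt := by
        intro A B hB
        by_cases hA : f A = []
        · simp [hA] at hB
        · rw [if_neg hA] at hB
          have := wstr_pos hw hA
          have := hweight A B hB
          omega
      start := Classical.arbitrary V }
  have hrhs : ∀ A, f A ≠ [] → G.rhs A = L A := fun A hA => if_neg hA
  have hnil : ∀ A, f A = [] → G.rhs A = [] := fun A hA => if_pos hA
  have hval : ∀ A, G.val A = f A := by
    intro A
    induction hr : G.rank A using Nat.strong_induction_on generalizing A with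
    | _ r ih =>
      have h1 : G.val A = expand f (G.rhs A) := by
        rw [G.val_eq_expand, expand, expand, List.flatMap_def, List.flatMap_def]
        congr 1
        refine List.map_congr_left fun β hβ => ?_
        rcases β with B | a
        · exact ih _ (hr ▸ G.rank_lt A B hβ) B rfl
        · rfl
      by_cases hA : f A = []
      · rw [h1, hnil A hA, hA]
        rfl
      · rw [h1, hrhs A hA, hexp A]
  refine ⟨G, fun A => ?_, fun A B hB => ?_, hval⟩
  · by_cases hA : f A = []
    · simp [hnil A hA]
    · exact hrhs A hA ▸ hlen A
  · rw [SLP.wval, SLP.wval, hval, hval]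
    by_cases hA : f A = []
    · simp [hnil A hA] at hB
    · exact hweight A B (hrhs A hA ▸ hB)

end slp

namespace LTree

variable {ν Γ : Type} (T : LTree ν Γ)

theorem prefixAt_root : T.prefixAt T.root = [] := by
  have h := (T.parent_eq_none T.root).2 rfl
  rw [prefixAt]
  split
  · rfl
  · simp_all

theorem prefixAt_of_parent {u v : ν} (huv : T.parent v = some u) :
    T.prefixAt v = T.prefixAt u ++ T.label v := by
  rw [prefixAt]
  split
  · simp_all
  · simp_all

theorem prefixAt_eq_nil (h : ∀ v, v ≠ T.root → T.label v = []) (v : ν) : T.prefixAt v = [] := by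
  induction hd : T.depth v using Nat.strong_induction_on generalizing v with
  | _ d ih =>
    cases hv : T.parent v with
    | none => rw [(T.parent_eq_none v).1 hv, prefixAt_root]
    | some u =>
      have hne : v ≠ T.root := fun hr => by simp [(T.parent_eq_none v).2 hr] at hv
      rw [T.prefixAt_of_parent hv, ih _ (hd ▸ T.depth_lt v u hv) u rfl, h v hne, List.append_nil]

/-- The underlying tree, where the potential of a node is the weight of its prefix. -/
def toWTree (w : Γ → ℕ) : WTree ν where
  E a b := T.parent b = some a
  dep := T.depth
  R v := wstr w (T.prefixAt v)
  dep_lt h := T.depth_lt _ _ h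
  uniq h h' := Option.some_injective _ (h.symm.trans h')
  R_le h := by simp [T.prefixAt_of_parent h, wstr_append]

/-- The string spelled by the path from `a` down to `b`. -/
def seg (a b : ν) : List Γ := (T.prefixAt b).drop (T.prefixAt a).length

variable {T} {w : Γ → ℕ}

theorem prefixAt_append_seg {a b : ν} (h : (T.toWTree w).Anc a b) :
    T.prefixAt a ++ T.seg a b = T.prefixAt b := by
  refine List.prefix_append_drop ?_ |>.symm
  induction h with
  | refl => exact List.prefix_rfl
  | tail _ he ih =>
    rw [T.prefixAt_of_parent he]
    exact ih.trans (List.prefix_append _ _)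

theorem seg_append_seg {a b c : ν} (hab : (T.toWTree w).Anc a b) (hbc : (T.toWTree w).Anc b c) :
    T.seg a b ++ T.seg b c = T.seg a c := by
  have h1 := prefixAt_append_seg (hab.trans hbc)
  rw [← prefixAt_append_seg hbc, ← prefixAt_append_seg hab, List.append_assoc] at h1
  exact (List.append_cancel_left h1).symm

theorem seg_self (a : ν) : T.seg a a = [] := List.drop_length

theorem seg_of_parent {a b : ν} (h : T.parent b = some a) : T.seg a b = T.label b := by
  rw [seg, T.prefixAt_of_parent h, List.drop_left]

theorem wstr_seg {a b : ν} (h : (T.toWTree w).Anc a b) :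
    wstr w (T.seg a b) = (T.toWTree w).R b - (T.toWTree w).R a := by
  have h1 : (T.toWTree w).R b = (T.toWTree w).R a + wstr w (T.seg a b) := by
    simp only [toWTree]
    rw [← wstr_append, prefixAt_append_seg h]
  omega

theorem isCluster_toWTree [Fintype ν] [DecidableEq ν] :
    (T.toWTree w).IsCluster T.root (Finset.univ.erase T.root) where
  root_notMem := Finset.notMem_erase _ _
  parent v hv := by
    cases h : T.parent v with
    | none => exact absurd ((T.parent_eq_none v).1 h) (Finset.ne_of_mem_erase hv)
    | some u =>
      refine ⟨u, h, ?_⟩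
      simpa using em _

theorem exists_rhs {F : Finset (ν × ν)} {W k ℓ : ℕ} (hℓ : 1 ≤ ℓ)
    (hlabel : ∀ v, v ≠ T.root → (T.label v).length ≤ ℓ) {a b : ν}
    (h : Pieces ((T.toWTree w).Light F W) k a b) :
    ∃ L : List (F ⊕ Γ), L.length ≤ k * ℓ ∧
      (∀ B, Sum.inl B ∈ L → 2 * wstr w (T.seg B.1.1 B.1.2) ≤ W) ∧
      expand (fun B : F => T.seg B.1.1 B.1.2) L = T.seg a b := by
  induction h with
  | nil k a => exact ⟨[], by simp, by simp, (seg_self a).symm⟩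
  | @cons k a b c hp hq ih =>
    obtain ⟨L, hlen, hweight, hexp⟩ := ih
    have hbc : (T.toWTree w).Anc b c :=
      hq.reflTransGen fun x y hxy => hxy.elim WTree.Anc.of_edge fun h => h.2.1
    rcases hp with he | ⟨hF, hab, hW⟩
    · refine ⟨(T.label b).map Sum.inr ++ L, ?_, ?_, ?_⟩
      · have hb : b ≠ T.root := fun hr => by
          have he' : T.parent b = some a := he
          simp [(T.parent_eq_none b).2 hr] at he'
        have := hlabel b hb
        rw [List.length_append, List.length_map, add_mul]
        omega
      · intro B hB
        exact hweight B (by simpa using hB)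
      · rw [expand_append, expand_map_inr, hexp, ← seg_of_parent he]
        exact seg_append_seg (.of_edge he) hbc
    · refine ⟨Sum.inl ⟨(a, b), hF⟩ :: L, ?_, ?_, ?_⟩
      · rw [List.length_cons, add_mul]
        omega
      · intro B hB
        rcases List.mem_cons.1 hB with hB | hB
        · obtain rfl := Sum.inl_injective hB
          rwa [wstr_seg hab]
        · exact hweight B hB
      · rw [← List.singleton_append, expand_append, hexp, ← seg_append_seg hab hbc]
        simp [expand]

end LTree

/-- There is a constant `c` such that for every labeled tree `T`
with `n ≥ 1` edges whose edge labels are strings of length at most `ℓ` over a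
weighted alphabet `Γ`, there is a contracting SLP over `Γ` with at most `c·n`
variables and right-hand sides of length at most `c·ℓ` that defines all nonempty
prefixes in `T`. -/
theorem tree_prefix_slp :
    ∃ c : ℕ,
      ∀ (Γ ν : Type) (instΓ : Fintype Γ) (instν : Fintype ν)
        (w : Γ → ℕ), (∀ a : Γ, 0 < w a) →
        ∀ (T : LTree ν Γ) (n ℓ : ℕ), 1 ≤ n →
          Fintype.card ν = n + 1 →
          (∀ v : ν, v ≠ T.root → (T.label v).length ≤ ℓ) →
          ∃ (V : Type) (instV : Fintype V) (G : SLP V Γ),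
            Fintype.card V ≤ c * n ∧
            (∀ A : V, (G.rhs A).length ≤ c * ℓ) ∧
            G.Contracting w ∧
            (∀ v : ν, T.prefixAt v ≠ [] → G.defines (T.prefixAt v)) := by
  refine ⟨816, fun Γ ν _ _ w hw T n ℓ hn hcard hlabel => ?_⟩
  rcases Nat.eq_zero_or_pos ℓ with rfl | hℓ
  · have hnil := T.prefixAt_eq_nil fun v hv => List.length_eq_zero_iff.1 (by simpa using hlabel v hv)
    obtain ⟨G, hlen, hG, -⟩ := exists_slp (V := Unit) hw (fun _ => []) (m := 0) fun _ =>
      ⟨[], by simp, by simp, rfl⟩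
    exact ⟨Unit, inferInstance, G, by simp; omega, hlen, hG, fun v hv => absurd (hnil v) hv⟩
  classical
  obtain ⟨F, hFcard, hF, hroot⟩ :=
    (T.toWTree w).exists_closed (s := T.root) (by convert T.isCluster_toWTree)
  have : Nonempty F := ⟨⟨_, hroot T.root⟩⟩
  obtain ⟨G, hlen, hG, hval⟩ := exists_slp (V := F) hw (fun B => T.seg B.1.1 B.1.2)
    (m := 230 * ℓ) fun A => by
      obtain ⟨hanc, hp⟩ := hF _ _ A.2
      rw [LTree.wstr_seg hanc]
      exact LTree.exists_rhs hℓ hlabel hp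
  refine ⟨F, inferInstance, G, ?_, fun A => (hlen A).trans (by omega), hG,
    fun v _ => ⟨⟨_, hroot v⟩, ?_⟩⟩
  · rw [Fintype.card_coe]
    omega
  · rw [hval]
    simp [LTree.seg, T.prefixAt_root]
end

section
/- Let T be a rooted tree with n leaves such that for every node v, the height of the subtree rooted at v is at most log₂ of the number of leaves of that subtree. Then the sum over all nodes v of T of the height of the subtree rooted at v is at most 2n. -/
/-- Finite rooted (ordered) trees. -/
inductive RTree : Type
  | node : List RTree → RTree

namespace RTree

/-- The height of a tree: the maximum number of edges on a root-to-leaf path. -/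
def height : RTree → ℕ
  | .node ts => (ts.attach.map fun t => t.1.height + 1).foldr max 0
decreasing_by
  simp only [RTree.node.sizeOf_spec]
  have := List.sizeOf_lt_of_mem t.2
  omega

/-- The number of leaves of a tree (a node with no children is a leaf). -/
def leafCount : RTree → ℕ
  | .node [] => 1
  | .node ts => (ts.attach.map fun t => t.1.leafCount).sum
decreasing_by
  simp only [RTree.node.sizeOf_spec]
  have := List.sizeOf_lt_of_mem t.2
  omega

/-- The list of all subtrees of a tree (one for each node). -/
def subtrees : RTree → List RTree
  | .node ts => .node ts :: (ts.attach.map fun t => t.1.subtrees).flatten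
decreasing_by
  simp only [RTree.node.sizeOf_spec]
  have := List.sizeOf_lt_of_mem t.2
  omega

end RTree

namespace RTree

theorem induction_on_children {P : RTree → Prop}
    (step : ∀ ts : List RTree, (∀ t ∈ ts, P t) → P (.node ts)) : ∀ T : RTree, P T
  | .node ts => step ts fun t _ => induction_on_children step t
decreasing_by
  have := List.sizeOf_lt_of_mem ‹t ∈ ts›
  simp only [RTree.node.sizeOf_spec]
  omega

theorem subtrees_node (ts : List RTree) :
    (node ts).subtrees = node ts :: (ts.map subtrees).flatten := by
  rw [subtrees, List.attach_map_val (f := subtrees)]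

theorem leafCount_node {ts : List RTree} (h : ts ≠ []) :
    (node ts).leafCount = (ts.map leafCount).sum := by
  rw [leafCount.eq_2 _ h, List.attach_map_val (f := leafCount)]

theorem leafCount_pos (T : RTree) : 0 < T.leafCount := by
  induction T using induction_on_children with
  | step ts ih =>
    cases ts with
    | nil => simp [leafCount]
    | cons t ts =>
      have := ih t List.mem_cons_self
      rw [leafCount_node (List.cons_ne_nil _ _), List.map_cons, List.sum_cons]
      omega

theorem height_lt_of_mem {t : RTree} {ts : List RTree} (h : t ∈ ts) :
    t.height < (node ts).height := by
  rw [height, List.attach_map_val (f := fun t : RTree => t.height + 1)]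
  induction ts with
  | nil => simp at h
  | cons a l ih =>
    simp only [List.map_cons, List.foldr_cons]
    rcases List.mem_cons.1 h with rfl | h
    · omega
    · have := ih h
      omega

theorem height_le_of_mem_subtrees (T : RTree) : ∀ S ∈ T.subtrees, S.height ≤ T.height := by
  induction T using induction_on_children with
  | step ts ih =>
    intro S hS
    rw [subtrees_node, List.mem_cons, List.mem_flatten] at hS
    rcases hS with rfl | ⟨l, hl, hS⟩
    · rfl
    · obtain ⟨t, ht, rfl⟩ := List.mem_map.1 hl
      exact (ih t ht S hS).trans (height_lt_of_mem ht).le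

/-- The subtrees of height `k` have disjoint sets of leaves. -/
theorem count_height_mul_two_pow_le (k : ℕ) (T : RTree)
    (hT : ∀ S ∈ T.subtrees, 2 ^ S.height ≤ S.leafCount) :
    (T.subtrees.map height).count k * 2 ^ k ≤ T.leafCount := by
  induction T using induction_on_children with
  | step ts ih =>
    rw [subtrees_node] at hT ⊢
    rw [List.map_cons, List.count_cons]
    by_cases hk : (node ts).height = k
    · have h0 : ((ts.map subtrees).flatten.map height).count k = 0 := by
        rw [List.count_eq_zero]
        intro hmem
        obtain ⟨S, hS, hSk⟩ := List.mem_map.1 hmem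
        obtain ⟨l, hl, hS⟩ := List.mem_flatten.1 hS
        obtain ⟨t, ht, rfl⟩ := List.mem_map.1 hl
        have := height_le_of_mem_subtrees t S hS
        have := height_lt_of_mem ht
        omega
      have := hT (node ts) List.mem_cons_self
      rw [h0]
      simpa only [hk, beq_self_eq_true, if_true, zero_add, one_mul] using this
    · have hchild : ∀ t ∈ ts, (t.subtrees.map height).count k * 2 ^ k ≤ t.leafCount :=
        fun t ht => ih t ht fun S hS => hT S (List.mem_cons_of_mem _
          (List.mem_flatten.2 ⟨_, List.mem_map_of_mem ht, hS⟩))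
      rcases eq_or_ne ts [] with rfl | hne
      · simp [hk]
      · rw [leafCount_node hne, List.map_flatten, List.count_flatten]
        simp only [beq_iff_eq, hk, if_false, add_zero, List.map_map]
        rw [← List.sum_map_mul_right]
        exact List.sum_le_sum hchild

end RTree

/-- If a list of naturals contains each `k` at most `n / 2 ^ k` times, its sum is at most `2 * n`. -/
theorem List.sum_le_two_mul_of_count_mul_two_pow_le (l : List ℕ) (n : ℕ)
    (h : ∀ k, l.count k * 2 ^ k ≤ n) : l.sum ≤ 2 * n := by
  have hs : HasSum (fun k : ℕ => (k : ℝ) * (1 / 2) ^ k) 2 := by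
    have := hasSum_coe_mul_geometric_of_norm_lt_one (r := (1 / 2 : ℝ)) (by norm_num)
    norm_num at this ⊢
    exact this
  have hfin := sum_le_hasSum l.toFinset (fun k _ => by positivity) hs
  rw [Finset.sum_list_count]
  have key : ((∑ k ∈ l.toFinset, l.count k • k : ℕ) : ℝ) ≤ 2 * n := by
    push_cast [smul_eq_mul]
    calc ∑ k ∈ l.toFinset, (l.count k : ℝ) * k
        ≤ ∑ k ∈ l.toFinset, n * ((k : ℝ) * (1 / 2) ^ k) := by
          refine Finset.sum_le_sum fun k _ => ?_
          have hk : (l.count k : ℝ) * 2 ^ k ≤ n := mod_cast h k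
          rw [← le_div_iff₀ (by positivity)] at hk
          calc (l.count k : ℝ) * k ≤ n / 2 ^ k * k := by gcongr
            _ = n * ((k : ℝ) * (1 / 2) ^ k) := by rw [one_div, inv_pow]; ring
      _ = n * ∑ k ∈ l.toFinset, (k : ℝ) * (1 / 2) ^ k := by rw [Finset.mul_sum]
      _ ≤ n * 2 := by gcongr
      _ = 2 * n := mul_comm _ _
  exact_mod_cast key

/-- Let `T` be a rooted tree with `n` leaves such that for every
node `v` the height of the subtree rooted at `v` is at most `log₂` of its number of
leaves. Then the sum over all nodes of the heights of their subtrees is at most `2n`. -/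
theorem sum_heights_le :
    ∀ T : RTree,
      (∀ T' ∈ T.subtrees, (T'.height : ℝ) ≤ Real.logb 2 (T'.leafCount : ℝ)) →
      (T.subtrees.map RTree.height).sum ≤ 2 * T.leafCount := by
  intro T hT
  refine List.sum_le_two_mul_of_count_mul_two_pow_le _ _ fun k =>
    RTree.count_height_mul_two_pow_le k T fun S hS => ?_
  have h := hT S hS
  rw [Real.le_logb_iff_rpow_le one_lt_two (mod_cast S.leafCount_pos), Real.rpow_natCast] at h
  exact_mod_cast h
end

section
/- For every weighted string s of length n ≥ 1 over a weighted alphabet Σ there exists an SLP over Σ with at most n variables whose start variable derives s, such that every right-hand side has length at most 4, every rule is contracting, and the SLP is left-heavy. -/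
/-- Weight of a string of symbols (variables or terminals). -/
def SLP.swstr {V Γ : Type} (G : SLP V Γ) (w : Γ → ℕ) (s : List (V ⊕ Γ)) : ℕ :=
  (s.map (G.symWeight w)).sum

/-- An SLP over a weighted alphabet is left-heavy if for every rule
`A → β₁…β_k` and every variable `β_i` with `i ≥ 2`, the weight of `β₁…β_{i-1}`
is at least the weight of `β_i`. -/
def SLP.LeftHeavy {V Γ : Type} (G : SLP V Γ) (w : Γ → ℕ) : Prop :=
  ∀ (A : V) (u : List (V ⊕ Γ)) (B : V) (v : List (V ⊕ Γ)),
    G.rhs A = u ++ Sum.inl B :: v → u ≠ [] → G.wval w B ≤ G.swstr w u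

theorem wstr_cons {Γ : Type} (w : Γ → ℕ) (a : Γ) (t : List Γ) :
    wstr w (a :: t) = w a + wstr w t := by
  simp [wstr]

theorem exists_weighted_median_of_append {Γ : Type} (w : Γ → ℕ) (v p : List Γ) (hv : v ≠ [])
    (hp : 2 * wstr w p ≤ wstr w (p ++ v)) :
    ∃ u a t, p ++ v = u ++ a :: t ∧ 2 * wstr w u ≤ wstr w (p ++ v) ∧
      2 * wstr w t ≤ wstr w (p ++ v) := by
  induction v generalizing p with
  | nil => exact absurd rfl hv
  | cons a v ih =>
    by_cases h : 2 * wstr w v ≤ wstr w (p ++ a :: v)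
    · exact ⟨p, a, v, rfl, hp, h⟩
    · have hne : v ≠ [] := by
        rintro rfl
        simp [wstr] at h
      have h' : 2 * wstr w (p ++ [a]) ≤ wstr w ((p ++ [a]) ++ v) := by
        simp only [wstr_append, wstr_cons] at h ⊢
        simp only [wstr, List.map_nil, List.sum_nil] at h ⊢
        omega
      simpa using ih (p ++ [a]) hne h'

/-- Every nonempty weighted string has a weighted median letter. -/
theorem exists_weighted_median {Γ : Type} (w : Γ → ℕ) (s : List Γ) (hs : s ≠ []) :
    ∃ u a t, s = u ++ a :: t ∧ 2 * wstr w u ≤ wstr w s ∧ 2 * wstr w t ≤ wstr w s := by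
  simpa using exists_weighted_median_of_append w s [] hs (by simp [wstr])

/-- Splitting recursively at weighted medians yields a set of at most `s.length` factors of `s`,
closed under splitting. -/
theorem exists_median_closed_finset {Γ : Type} (w : Γ → ℕ) (s : List Γ) :
    ∃ S : Finset (List Γ), S.card ≤ s.length ∧ [] ∉ S ∧ (s ≠ [] → s ∈ S) ∧
      ∀ t ∈ S, ∃ u a v, t = u ++ a :: v ∧ 2 * wstr w u ≤ wstr w t ∧ 2 * wstr w v ≤ wstr w t ∧
        (u ≠ [] → u ∈ S) ∧ (v ≠ [] → v ∈ S) := by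
  classical
  induction hn : s.length using Nat.strong_induction_on generalizing s with
  | _ n ih =>
    subst hn
    by_cases hs : s = []
    · subst hs
      exact ⟨∅, by simp⟩
    obtain ⟨u, a, v, hsp, hu, hv⟩ := exists_weighted_median w s hs
    have hlen : s.length = u.length + v.length + 1 := by
      rw [hsp, List.length_append, List.length_cons, Nat.add_assoc]
    obtain ⟨S, hSc, hSn, hSs, hSt⟩ := ih u.length (by omega) u rfl
    obtain ⟨T, hTc, hTn, hTs, hTt⟩ := ih v.length (by omega) v rfl
    refine ⟨insert s (S ∪ T), ?_, ?_, fun _ => Finset.mem_insert_self _ _, ?_⟩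
    · have h₁ := Finset.card_insert_le s (S ∪ T)
      have h₂ := Finset.card_union_le S T
      omega
    · simp [hSn, hTn, Ne.symm hs]
    · intro t ht
      simp only [Finset.mem_insert, Finset.mem_union] at ht ⊢
      rcases ht with rfl | ht | ht
      · exact ⟨u, a, v, hsp, hu, hv, fun h => .inr (.inl (hSs h)), fun h => .inr (.inr (hTs h))⟩
      · obtain ⟨u', a', v', h, h₁, h₂, h₃, h₄⟩ := hSt t ht
        exact ⟨u', a', v', h, h₁, h₂, fun h => .inr (.inl (h₃ h)), fun h => .inr (.inl (h₄ h))⟩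
      · obtain ⟨u', a', v', h, h₁, h₂, h₃, h₄⟩ := hTt t ht
        exact ⟨u', a', v', h, h₁, h₂, fun h => .inr (.inr (h₃ h)), fun h => .inr (.inr (h₄ h))⟩

namespace SLP

/-- The string derived by a symbol. -/
def symVal {V Γ : Type} (G : SLP V Γ) : V ⊕ Γ → List Γ
  | Sum.inl B => G.val B
  | Sum.inr a => [a]

theorem val_eq_flatten {V Γ : Type} (G : SLP V Γ) (A : V) :
    G.val A = ((G.rhs A).map G.symVal).flatten := by
  rw [val]
  conv_rhs => rw [← List.attach_map_subtype_val (G.rhs A), List.map_map]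
  congr 1
  refine List.map_congr_left ?_
  rintro ⟨_ | _, _⟩ _ <;> rfl

end SLP

open Classical in
/-- The symbol string consisting of the variable `u`, or nothing if `u` is not a variable. -/
noncomputable def symOfMem {Γ : Type} (S : Finset (List Γ)) (u : List Γ) :
    List ({t // t ∈ S} ⊕ Γ) :=
  if h : u ∈ S then [Sum.inl ⟨u, h⟩] else []

theorem symOfMem_eq {Γ : Type} {S : Finset (List Γ)} {u : List Γ} (hS : [] ∉ S)
    (hu : u ≠ [] → u ∈ S) :
    u = [] ∧ symOfMem S u = [] ∨ ∃ h : u ∈ S, symOfMem S u = [Sum.inl ⟨u, h⟩] := by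
  by_cases h : u = []
  · subst h
    simp [symOfMem, hS]
  · exact .inr ⟨hu h, by simp [symOfMem, hu h]⟩

/-- For every weighted string `s` of length `n ≥ 1` over a weighted
alphabet `Γ` there exists an SLP over `Γ` with at most `n` variables whose start
variable derives `s`, whose right-hand sides have length at most `4`, which is
contracting, and which is left-heavy. -/
theorem base_slp_exists :
    ∀ (Γ : Type) (instΓ : Fintype Γ) (w : Γ → ℕ), (∀ a : Γ, 0 < w a) →
      ∀ s : List Γ, s ≠ [] →
        ∃ (V : Type) (instV : Fintype V) (G : SLP V Γ),
          Fintype.card V ≤ s.length ∧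
          G.val G.start = s ∧
          (∀ A : V, (G.rhs A).length ≤ 4) ∧
          G.Contracting w ∧
          G.LeftHeavy w := by
  intro Γ _ w _ s hs
  obtain ⟨S, hcard, hnil, hsS, hS⟩ := exists_median_closed_finset w s
  have : Nonempty Γ := ⟨s.head hs⟩
  choose! u a v hsplit hu hv huS hvS using hS
  have hsplit' : ∀ A : {t // t ∈ S}, A.1.length = (u A.1).length + (v A.1).length + 1 := by
    intro A
    conv_lhs => rw [hsplit A.1 A.2]
    rw [List.length_append, List.length_cons, Nat.add_assoc]
  have hsymu (A : {t // t ∈ S}) := symOfMem_eq hnil (huS A.1 A.2)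
  have hsymv (A : {t // t ∈ S}) := symOfMem_eq hnil (hvS A.1 A.2)
  let rhs : {t // t ∈ S} → List ({t // t ∈ S} ⊕ Γ) := fun A =>
    symOfMem S (u A.1) ++ Sum.inr (a A.1) :: symOfMem S (v A.1)
  have hmem : ∀ A B, Sum.inl B ∈ rhs A → B.1 = u A.1 ∨ B.1 = v A.1 := by
    intro A B h
    simp only [rhs] at h
    rcases hsymu A with ⟨-, e⟩ | ⟨_, e⟩ <;> rcases hsymv A with ⟨-, f⟩ | ⟨_, f⟩ <;>
      rw [e, f] at h <;> simp at h <;> grind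
  let G : SLP {t // t ∈ S} Γ :=
    { rhs := rhs
      rank := fun A => A.1.length
      rank_lt := by
        intro A B h
        have := hsplit' A
        rcases hmem A B h with h | h <;> rw [h] <;> omega
      start := ⟨s, hsS hs⟩ }
  have hval : ∀ A, G.val A = A.1 := by
    intro A
    induction hn : A.1.length using Nat.strong_induction_on generalizing A with
    | _ n ih =>
      subst hn
      have hl := hsplit' A
      rw [SLP.val_eq_flatten]
      conv_rhs => rw [hsplit A.1 A.2]
      change (List.map G.symVal (rhs A)).flatten = _
      simp only [rhs]
      rcases hsymu A with ⟨hu0, e⟩ | ⟨hu1, e⟩ <;> rcases hsymv A with ⟨hv0, f⟩ | ⟨hv1, f⟩ <;>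
        rw [e, f] <;> simp only [List.map_append, List.map_cons, List.map_nil, SLP.symVal]
      · simp [hu0, hv0]
      · rw [ih _ (by dsimp only; omega) ⟨_, hv1⟩ rfl]
        simp [hu0]
      · rw [ih _ (by dsimp only; omega) ⟨_, hu1⟩ rfl]
        simp [hv0]
      · rw [ih _ (by dsimp only; omega) ⟨_, hu1⟩ rfl,
          ih _ (by dsimp only; omega) ⟨_, hv1⟩ rfl]
        simp
  have hwval : ∀ A, G.wval w A = wstr w A.1 := fun A => by rw [SLP.wval, hval]
  refine ⟨{t // t ∈ S}, inferInstance, G, by simpa using hcard, hval _, ?_, ?_, ?_⟩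
  · intro A
    change (rhs A).length ≤ 4
    simp only [rhs]
    rcases hsymu A with ⟨-, e⟩ | ⟨_, e⟩ <;> rcases hsymv A with ⟨-, f⟩ | ⟨_, f⟩ <;>
      rw [e, f] <;> simp
  · intro A B h
    rw [hwval, hwval]
    rcases hmem A B h with h | h <;> rw [h]
    · exact hu A.1 A.2
    · exact hv A.1 A.2
  · intro A x B y h hx
    change rhs A = _ at h
    have hweight : wstr w A.1 = wstr w (u A.1) + (w (a A.1) + wstr w (v A.1)) := by
      conv_lhs => rw [hsplit A.1 A.2]
      rw [wstr_append, wstr_cons]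
    have hvA := hv A.1 A.2
    have hzero : wstr w [] = 0 := rfl
    simp only [rhs] at h
    rcases hsymu A with ⟨hu0, e⟩ | ⟨hu1, e⟩ <;> rcases hsymv A with ⟨hv0, f⟩ | ⟨hv1, f⟩ <;>
      rw [e, f] at h <;>
      simp [List.cons_eq_append_iff, hx] at h
    · obtain ⟨rfl, rfl, rfl⟩ := h
      simp only [hwval, SLP.swstr, SLP.symWeight, List.map_cons, List.map_nil, List.sum_cons,
        List.sum_nil]
      rw [hu0] at hweight
      omega
    · obtain ⟨rfl, rfl, rfl⟩ := h
      simp only [hwval, SLP.swstr, SLP.symWeight, List.map_cons, List.map_nil, List.sum_cons,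
        List.sum_nil]
      omega
end

section
/- For n ≥ 1 and 1 ≤ i ≤ n let T_i = b a^{2i−2} b a^{2i−1} b and let s_n = T_1 a^{2^n} T_2 a^{2^n} ⋯ T_{n−1} a^{2^n} T_n be a string over {a,b}. Then for every 0 ≤ k ≤ 2n−1, the string b a^k b occurs exactly once as a factor (contiguous substring) of s_n. -/
/-- The separator string `T_i = b a^(2i−2) b a^(2i−1) b` over the alphabet `{a,b}`,
where `a` is modelled by `false` and `b` by `true`. -/
def Tsep (i : ℕ) : List Bool :=
  [true] ++ List.replicate (2 * i - 2) false ++ [true] ++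
    List.replicate (2 * i - 1) false ++ [true]

/-- The string `s_n = T_1 a^(2^n) T_2 a^(2^n) ⋯ T_{n−1} a^(2^n) T_n`. -/
def sepString (n : ℕ) : List Bool :=
  (List.range n).flatMap fun j =>
    Tsep (j + 1) ++ if j + 1 < n then List.replicate (2 ^ n) false else []

/-- The word `b a^(l₁) b a^(l₂) b ⋯ b a^(lᵣ) b` whose successive gaps are `l₁, …, lᵣ`. -/
def gapWord : List ℕ → List Bool
  | [] => [true]
  | l :: L => true :: (List.replicate l false ++ gapWord L)

theorem gapWord_eq_cons (L : List ℕ) : ∃ t, gapWord L = true :: t := by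
  cases L <;> simp [gapWord]

theorem replicate_append_true_prefix_iff (k l : ℕ) (t : List Bool) :
    (List.replicate k false ++ [true]) <+: (List.replicate l false ++ true :: t) ↔ k = l := by
  induction k generalizing l with
  | zero => cases l <;> simp [List.replicate_succ]
  | succ k ih =>
    cases l with
    | zero => simp [List.replicate_succ]
    | succ l => simpa [List.replicate_succ] using ih l

theorem prefix_drop_gapWord_cons_iff (k l : ℕ) (L : List ℕ) (i : ℕ) :
    ([true] ++ List.replicate k false ++ [true]) <+: (gapWord (l :: L)).drop i ↔
      (i = 0 ∧ k = l) ∨ ∃ j, i = l + 1 + j ∧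
        ([true] ++ List.replicate k false ++ [true]) <+: (gapWord L).drop j := by
  rcases Nat.eq_zero_or_pos i with rfl | hi
  · obtain ⟨t, ht⟩ := gapWord_eq_cons L
    have h := replicate_append_true_prefix_iff k l t
    have h' : ∀ j, 0 ≠ l + 1 + j := by omega
    simp [gapWord, ht, h, h']
  · obtain ⟨i, rfl⟩ := Nat.exists_eq_add_of_le' hi
    by_cases hil : i < l
    · have h' : ∀ j, i + 1 ≠ l + 1 + j := by omega
      obtain ⟨d, hd⟩ : ∃ d, l - i = d + 1 := ⟨l - i - 1, by omega⟩
      simp [gapWord, List.drop_append, hd, h', List.replicate_succ]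
    · obtain ⟨j, rfl⟩ := Nat.exists_eq_add_of_le (not_lt.mp hil)
      have h' : ∀ j', l + j + 1 = l + 1 + j' ↔ j' = j := by omega
      simp [gapWord, List.drop_append, h']

theorem not_prefix_drop_gapWord {k : ℕ} {L : List ℕ} (hk : k ∉ L) (i : ℕ) :
    ¬ ([true] ++ List.replicate k false ++ [true]) <+: (gapWord L).drop i := by
  induction L generalizing i with
  | nil =>
    intro h
    have := h.length_le
    simp [gapWord] at this
    omega
  | cons l L ih =>
    rw [prefix_drop_gapWord_cons_iff]
    rintro (⟨-, rfl⟩ | ⟨j, -, hj⟩)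
    · simp at hk
    · exact ih (fun h => hk (List.mem_cons_of_mem _ h)) j hj

theorem existsUnique_prefix_drop_gapWord {k : ℕ} {L : List ℕ} (hk : L.count k = 1) :
    ∃! i, ([true] ++ List.replicate k false ++ [true]) <+: (gapWord L).drop i := by
  induction L with
  | nil => simp at hk
  | cons l L ih =>
    simp only [prefix_drop_gapWord_cons_iff]
    by_cases hkl : k = l
    · subst hkl
      have hL : k ∉ L := by simpa [List.count_eq_zero] using hk
      refine ⟨0, Or.inl ⟨rfl, rfl⟩, ?_⟩
      rintro i (⟨rfl, -⟩ | ⟨j, -, hj⟩)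
      · rfl
      · exact absurd hj (not_prefix_drop_gapWord hL j)
    · obtain ⟨j, hj, huniq⟩ := ih (by rwa [List.count_cons_of_ne (Ne.symm hkl)] at hk)
      refine ⟨l + 1 + j, Or.inr ⟨j, rfl, hj⟩, ?_⟩
      rintro i (⟨-, h⟩ | ⟨q, rfl, hq⟩)
      · exact absurd h hkl
      · rw [huniq q hq]

/-- The gaps of `T_1 a^c T_2 a^c ⋯ T_m a^c b`. -/
def sepGaps (c m : ℕ) : List ℕ :=
  (List.range m).flatMap fun j => [2 * j, 2 * j + 1, c]

theorem flatMap_Tsep_append_gapWord (c m : ℕ) (L : List ℕ) :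
    ((List.range m).flatMap fun j => Tsep (j + 1) ++ List.replicate c false) ++ gapWord L =
      gapWord (sepGaps c m ++ L) := by
  induction m generalizing L with
  | zero => simp [sepGaps]
  | succ m ih =>
    have h := ih (2 * m :: (2 * m + 1) :: c :: L)
    have h₀ : 2 * (m + 1) - 2 = 2 * m := by omega
    have h₁ : 2 * (m + 1) - 1 = 2 * m + 1 := by omega
    simp only [sepGaps, List.range_succ, List.flatMap_append, List.flatMap_singleton,
      List.append_assoc, List.cons_append, List.nil_append] at h ⊢
    rw [← h]
    simp [Tsep, gapWord, h₀, h₁]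

theorem sepString_succ (m : ℕ) :
    sepString (m + 1) = gapWord (sepGaps (2 ^ (m + 1)) m ++ [2 * m, 2 * m + 1]) := by
  have h₀ : 2 * (m + 1) - 2 = 2 * m := by omega
  have h₁ : 2 * (m + 1) - 1 = 2 * m + 1 := by omega
  have hT : Tsep (m + 1) = gapWord [2 * m, 2 * m + 1] := by simp [Tsep, gapWord, h₀, h₁]
  rw [← flatMap_Tsep_append_gapWord, ← hT, sepString, List.range_succ, List.flatMap_append,
    List.flatMap_singleton, if_neg (lt_irrefl _), List.append_nil]
  congr 1
  refine List.flatMap_congr fun j hj => ?_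
  rw [if_pos (by simpa using hj)]

theorem count_sepGaps {c k : ℕ} (hk : k ≠ c) (m : ℕ) :
    (sepGaps c m).count k = if k < 2 * m then 1 else 0 := by
  induction m with
  | zero => simp [sepGaps]
  | succ m ih =>
    simp only [sepGaps, List.range_succ, List.flatMap_append, List.flatMap_singleton,
      List.count_append] at ih ⊢
    rw [ih]
    simp only [List.count_cons, List.count_nil, beq_iff_eq]
    grind

/-- For every `n ≥ 1` and every `0 ≤ k ≤ 2n−1`, the string
`b a^k b` occurs exactly once as a factor of `s_n`, i.e. there is exactly one
position `i` at which `b a^k b` is a prefix of the suffix `s_n.drop i`. -/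
theorem separator_unique_occurrence :
    ∀ n k : ℕ, 1 ≤ n → k ≤ 2 * n - 1 →
      ∃! i : ℕ, ([true] ++ List.replicate k false ++ [true]) <+: (sepString n).drop i := by
  intro n k hn hk
  obtain ⟨m, rfl⟩ := Nat.exists_eq_add_of_le' hn
  have hpow : m + 1 ≤ 2 ^ m := Nat.lt_two_pow_self
  rw [sepString_succ]
  apply existsUnique_prefix_drop_gapWord
  rw [List.count_append, count_sepGaps (by rw [pow_succ]; omega)]
  simp only [List.count_cons, List.count_nil, beq_iff_eq]
  grind
end
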